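/- arXiv:1906.05927 — 5 statements merged into one kernel-verified Lean document; each statement's English description precedes it below -/
import Mathlib

section
/- Assume Dickson's conjecture. Then the set of real numbers { φ(p+1)/φ(p-1) : p is prime and p+2 is prime } is dense in [0, ∞), i.e., every real number x ≥ 0 is a limit point of this set. -/
/-- **Dickson's conjecture**: for every finite family of linear polynomials
`fᵢ(t) = aᵢ t + bᵢ` with integer coefficients and positive leading coefficients `aᵢ > 0`,
if no prime `q` divides the product `f₁(t) ⋯ f_k(t)` for every integer `t`, then there are
infinitely many natural numbers `t` at which all the `fᵢ(t)` are simultaneously prime. -/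
def DicksonConjecture : Prop :=
  ∀ (k : ℕ) (a b : Fin k → ℤ),
    (∀ i, 0 < a i) →
    (∀ q : ℕ, q.Prime → ∃ t : ℤ, ¬ ((q : ℤ) ∣ ∏ i, (a i * t + b i))) →
    {t : ℕ | ∀ i, Prime (a i * (t : ℤ) + b i)}.Infinite

open Filter Topology

/-- The four linear forms cutting out twin primes `p`, `p + 2` with `p + 1 = 12 a P` and
`p - 1 = 2 b Q` for primes `P`, `Q` have no fixed prime divisor. -/
lemma twin_forms_admissible {a b c d : ℤ} (h : 6 * a * c - b * d = 1) {q : ℕ} (hq : q.Prime) :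
    ∃ t : ℤ, ¬ ((q : ℤ) ∣ (b * t + c) * (6 * a * t + d) *
      (12 * a * (b * t + c) - 1) * (12 * a * (b * t + c) + 1)) := by
  have : Fact q.Prime := ⟨hq⟩
  have key : ∃ t : ZMod q, ((b : ZMod q) * t + c) * (6 * a * t + d) *
      (12 * a * (b * t + c) - 1) * (12 * a * (b * t + c) + 1) ≠ 0 := by
    have h' : (6 * a * c - b * d : ZMod q) = 1 := by
      exact_mod_cast congrArg (Int.cast (R := ZMod q)) h
    generalize (a : ZMod q) = a at *
    generalize (b : ZMod q) = b at *
    generalize (c : ZMod q) = c at *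
    generalize (d : ZMod q) = d at *
    by_cases ha : 6 * a = 0
    · have hd : b * d = -1 := by linear_combination -h' + c * ha
      have hb : b ≠ 0 := by rintro rfl; simp at hd
      have hd0 : d ≠ 0 := by rintro rfl; simp at hd
      refine ⟨(1 - c) / b, ?_⟩
      have e1 : b * ((1 - c) / b) + c = 1 := by field_simp; ring
      have e2 : (12 * a : ZMod q) = 0 := by linear_combination 2 * ha
      simp [e1, ha, e2, hd0]
    · have h6 : (6 : ZMod q) ≠ 0 := left_ne_zero_of_mul ha
      have h2 : (2 : ZMod q) ≠ 0 := fun h => h6 (by linear_combination 3 * h)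
      have h3 : (3 : ZMod q) ≠ 0 := fun h => h6 (by linear_combination 2 * h)
      have h12 : 12 * a ≠ 0 := by
        intro h0
        exact mul_ne_zero h2 ha (by linear_combination h0)
      by_cases hb : b = 0
      · have hc : 6 * a * c = 1 := by rw [hb] at h'; linear_combination h'
        have hc0 : c ≠ 0 := by rintro rfl; simp at hc
        refine ⟨(1 - d) / (6 * a), ?_⟩
        have e1 : 6 * a * ((1 - d) / (6 * a)) + d = 1 := by
          rw [mul_div_cancel₀ _ ha]; ring
        have e2 : 12 * a * c - 1 = 1 := by linear_combination 2 * hc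
        have e3 : 12 * a * c + 1 = 3 := by linear_combination 2 * hc
        rw [e1, hb, zero_mul, zero_add, e2, e3]
        simp [hc0, h3]
      · have hq5 : 4 < q := by
          by_contra! hle
          have := hq.two_le
          interval_cases q
          · exact h2 rfl
          · exact h3 rfl
          · exact absurd hq (by norm_num)
        let F : Finset (ZMod q) := {-c / b, -d / (6 * a), (1 / (12 * a) - c) / b,
          (-1 / (12 * a) - c) / b}
        obtain ⟨t, ht⟩ : ∃ t, t ∉ F := by
          by_contra! hall
          have hF : F = Finset.univ := Finset.eq_univ_iff_forall.2 hall
          have h4 : F.card ≤ 4 := Finset.card_le_four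
          rw [hF, Finset.card_univ, ZMod.card] at h4
          omega
        simp only [F, Finset.mem_insert, Finset.mem_singleton, not_or] at ht
        obtain ⟨t1, t2, t3, t4⟩ := ht
        rw [eq_div_iff hb] at t1 t3 t4
        rw [eq_div_iff ha] at t2
        refine ⟨t, mul_ne_zero (mul_ne_zero (mul_ne_zero ?_ ?_) ?_) ?_⟩
        · exact fun h0 => t1 (by linear_combination h0)
        · exact fun h0 => t2 (by linear_combination h0)
        · refine fun h0 => t3 ?_
          rw [eq_sub_iff_add_eq, eq_div_iff h12]
          linear_combination h0
        · refine fun h0 => t4 ?_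
          rw [eq_sub_iff_add_eq, eq_div_iff h12]
          linear_combination h0
  obtain ⟨t, ht⟩ := key
  obtain ⟨t, rfl⟩ := ZMod.intCast_surjective t
  refine ⟨t, fun hdvd => ht ?_⟩
  exact_mod_cast (ZMod.intCast_zmod_eq_zero_iff_dvd _ q).2 hdvd

/-- Under Dickson's conjecture, `φ(12a)/φ(2b) · b/(6a)` is a limit of totient ratios at twin
primes whenever `6a` and `b` are coprime. -/
lemma mem_closure_twin_ratio (hD : DicksonConjecture) {a b : ℕ} (ha : 0 < a) (hb : 0 < b)
    (hab : Nat.Coprime (6 * a) b) :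
    ((12 * a).totient : ℝ) / (2 * b).totient * (b / (6 * a)) ∈
      closure {r : ℝ | ∃ p : ℕ, Nat.Prime p ∧ Nat.Prime (p + 2) ∧
        r = (Nat.totient (p + 1) : ℝ) / (Nat.totient (p - 1) : ℝ)} := by
  obtain ⟨c, d, hcd⟩ : ∃ c d : ℤ, 6 * (a : ℤ) * c - b * d = 1 := by
    obtain ⟨u, v, huv⟩ := Nat.isCoprime_iff_coprime.2 hab
    refine ⟨u, -v, ?_⟩
    push_cast at huv
    linear_combination huv
  have hinf := hD 4 ![b, 6 * a, 12 * a * b, 12 * a * b]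
    ![c, d, 12 * a * c - 1, 12 * a * c + 1]
    (by intro i; fin_cases i <;> simp <;> positivity)
    (by
      intro q hq
      obtain ⟨t, ht⟩ := twin_forms_admissible hcd hq
      refine ⟨t, ?_⟩
      convert ht using 2
      simp [Fin.prod_univ_four]
      ring)
  have hfreq := Nat.frequently_atTop_iff_infinite.2 hinf
  have hlim : Tendsto (fun t : ℕ => ((12 * a).totient : ℝ) / (2 * b).totient *
      (((c - 1 : ℝ) + b * t) / ((d - 1 : ℝ) + 6 * a * t))) atTop
      (𝓝 (((12 * a).totient : ℝ) / (2 * b).totient * (b / (6 * a)))) :=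
    (tendsto_add_mul_div_add_mul_atTop_nhds _ _ _ (by positivity)).const_mul _
  refine mem_closure_of_frequently_of_tendsto ?_ hlim
  have hlarge : ∀ᶠ t : ℕ in atTop, 12 * (a : ℤ) - c < t ∧ 2 * (b : ℤ) - d < t := by
    filter_upwards [eventually_gt_atTop (12 * (a : ℤ) - c).toNat,
      eventually_gt_atTop (2 * (b : ℤ) - d).toNat] with t h1 h2
    omega
  refine (hfreq.and_eventually hlarge).mono ?_
  rintro t ⟨hp, h1, h2⟩
  have hP := hp 0
  have hQ := hp 1
  have hp1 := hp 2
  have hp2 := hp 3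
  simp at hP hQ hp1 hp2
  have hPl : 12 * (a : ℤ) < b * t + c := by nlinarith
  have hQl : 2 * (b : ℤ) < 6 * a * t + d := by nlinarith
  obtain ⟨P, hPe⟩ : ∃ P : ℕ, (P : ℤ) = b * t + c := ⟨_, Int.toNat_of_nonneg (by omega)⟩
  obtain ⟨Q, hQe⟩ : ∃ Q : ℕ, (Q : ℤ) = 6 * a * t + d := ⟨_, Int.toNat_of_nonneg (by omega)⟩
  rw [← hPe] at hP hPl
  rw [← hQe] at hQ hQl
  have hPN : P.Prime := Nat.prime_iff_prime_int.2 hP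
  have hQN : Q.Prime := Nat.prime_iff_prime_int.2 hQ
  have hrel : 12 * a * P = 2 * b * Q + 2 := by
    zify
    rw [hPe, hQe]
    linear_combination 2 * hcd
  refine ⟨2 * b * Q + 1, ?_, ?_, ?_⟩
  · rw [Nat.prime_iff_prime_int]
    convert hp1 using 1
    zify at hrel
    push_cast
    rw [hPe] at hrel
    linear_combination -hrel
  · rw [Nat.prime_iff_prime_int]
    convert hp2 using 1
    zify at hrel
    push_cast
    rw [hPe] at hrel
    linear_combination -hrel
  · rw [show 2 * b * Q + 1 + 1 = 12 * a * P by omega, Nat.add_sub_cancel]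
    have hcP : Nat.Coprime (12 * a) P :=
      (hPN.coprime_iff_not_dvd.2 fun hdvd => by
        have := Nat.le_of_dvd (by positivity) hdvd
        omega).symm
    have hcQ : Nat.Coprime (2 * b) Q :=
      (hQN.coprime_iff_not_dvd.2 fun hdvd => by
        have := Nat.le_of_dvd (by positivity) hdvd
        omega).symm
    rw [Nat.totient_mul hcP, Nat.totient_mul hcQ, Nat.totient_prime hPN, Nat.totient_prime hQN]
    push_cast [hPN.one_le, hQN.one_le]
    have eP : (P : ℝ) = b * t + c := by exact_mod_cast hPe
    have eQ : (Q : ℝ) = 6 * a * t + d := by exact_mod_cast hQe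
    rw [eP, eQ, mul_div_mul_comm]
    congr 2 <;> ring

/-- The partial products of `1 - 1/p` over primes `p ≥ N` get arbitrarily small. -/
lemma exists_prod_one_sub_inv_prime_lt (N : ℕ) {y : ℝ} (hy : 0 < y) :
    ∃ k : ℕ, ∏ p ∈ (Finset.Ico N (N + k)).filter Nat.Prime, (1 - 1 / (p : ℝ)) ≤ y := by
  have hns : ¬ Summable (Set.indicator {p : ℕ | p.Prime} (fun n : ℕ => (1 : ℝ) / n)) :=
    not_summable_one_div_on_primes
  rw [← summable_nat_add_iff N] at hns
  have htend := (not_summable_iff_tendsto_nat_atTop_of_nonneg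
    (fun n => Set.indicator_nonneg (fun _ _ => by positivity) _)).1 hns
  obtain ⟨k, hk⟩ := (htend.eventually_ge_atTop (-Real.log y)).exists
  refine ⟨k, ?_⟩
  have hsum : ∑ i ∈ Finset.range k,
      Set.indicator {p : ℕ | p.Prime} (fun n : ℕ => (1 : ℝ) / n) (i + N) =
      ∑ p ∈ (Finset.Ico N (N + k)).filter Nat.Prime, 1 / (p : ℝ) := by
    rw [Finset.sum_filter, Finset.sum_Ico_eq_sum_range, Nat.add_sub_cancel_left]
    refine Finset.sum_congr rfl fun i _ => ?_
    rw [Set.indicator_apply, add_comm i N]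
    rfl
  rw [hsum] at hk
  calc ∏ p ∈ (Finset.Ico N (N + k)).filter Nat.Prime, (1 - 1 / (p : ℝ))
      ≤ ∏ p ∈ (Finset.Ico N (N + k)).filter Nat.Prime, Real.exp (-(1 / (p : ℝ))) := by
        refine Finset.prod_le_prod (fun p hp => ?_) (fun p _ => Real.one_sub_le_exp_neg _)
        have : (1 : ℝ) ≤ p := by exact_mod_cast (Finset.mem_filter.1 hp).2.one_le
        rw [sub_nonneg, div_le_one (by linarith)]
        exact this
    _ = Real.exp (-∑ p ∈ (Finset.Ico N (N + k)).filter Nat.Prime, 1 / (p : ℝ)) := by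
        rw [← Real.exp_sum, Finset.sum_neg_distrib]
    _ ≤ y := by
        rw [← Real.le_log_iff_exp_le hy]
        linarith

lemma totient_prod_primes_div (s : Finset ℕ) (hs : ∀ p ∈ s, p.Prime) :
    ((∏ p ∈ s, p : ℕ).totient : ℝ) / (∏ p ∈ s, p : ℕ) = ∏ p ∈ s, (1 - 1 / (p : ℝ)) := by
  have hpos : 0 < ∏ p ∈ s, p := Finset.prod_pos fun p hp => (hs p hp).pos
  have h : ((∏ p ∈ s, p : ℕ).totient : ℝ) =
      (∏ p ∈ s, p : ℕ) * ∏ p ∈ (∏ p ∈ s, p : ℕ).primeFactors, (1 - (p : ℝ)⁻¹) := by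
    have := congrArg (Rat.cast (K := ℝ)) (Nat.totient_eq_mul_prod_factors (∏ p ∈ s, p))
    push_cast at this ⊢
    exact this
  rw [h, Nat.primeFactors_prod hs, mul_div_cancel_left₀ _ (by positivity)]
  simp

/-- The values `φ(n)/n` with `n` coprime to `m` are dense in `(0, 1]`. -/
lemma exists_coprime_totient_div_close {m : ℕ} (hm : 0 < m) {y ε : ℝ} (hy : 0 < y) (hy1 : y ≤ 1)
    (hε : 0 < ε) :
    ∃ n : ℕ, 0 < n ∧ Nat.Coprime m n ∧ |(n.totient : ℝ) / n - y| < ε := by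
  obtain ⟨M, hM⟩ := exists_nat_gt (1 / ε)
  set N := max M (m + 1)
  have hNε : 1 / (N : ℝ) < ε := by
    have hMN : (M : ℝ) ≤ N := by exact_mod_cast le_max_left _ _
    have hpos : 0 < 1 / ε := by positivity
    rw [div_lt_comm₀ (by linarith) hε]
    linarith
  let g : ℕ → ℝ := fun k =>
    ∏ p ∈ (Finset.Ico N (N + k)).filter Nat.Prime, (1 - 1 / (p : ℝ))
  have hex : ∃ k, g k ≤ y := exists_prod_one_sub_inv_prime_lt N hy
  obtain ⟨k, hk, hlow⟩ : ∃ k, g k ≤ y ∧ y - 1 / N ≤ g k := by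
    classical
    refine ⟨Nat.find hex, Nat.find_spec hex, ?_⟩
    have hN0 : (0 : ℝ) ≤ 1 / N := by positivity
    rcases hf : Nat.find hex with _ | j
    · simp only [g, add_zero, Finset.Ico_self, Finset.filter_empty, Finset.prod_empty]
      linarith
    · have hj : y < g j := not_le.1 (Nat.find_min hex (by omega))
      have hstep : g (j + 1) =
          if (N + j).Prime then (1 - 1 / ((N + j : ℕ) : ℝ)) * g j else g j := by
        simp only [g]
        rw [← add_assoc, ← Finset.insert_Ico_right_eq_Ico_add_one (by omega), Finset.filter_insert]
        split_ifs
        · rw [Finset.prod_insert (by simp)]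
        · rfl
      have hgj : g j ≤ 1 := by
        refine Finset.prod_le_one (fun p hp => ?_) (fun p _ => ?_)
        · have : (1 : ℝ) ≤ p := by exact_mod_cast (Finset.mem_filter.1 hp).2.one_le
          rw [sub_nonneg, div_le_one (by linarith)]
          exact this
        · have : (0 : ℝ) ≤ 1 / p := by positivity
          linarith
      rw [hstep]
      split_ifs
      · have hNpos : (0 : ℝ) < N := by
          have : 0 < N := lt_of_lt_of_le (Nat.succ_pos m) (le_max_right _ _)
          exact_mod_cast this
        have hle : 1 / ((N + j : ℕ) : ℝ) ≤ 1 / N := by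
          apply one_div_le_one_div_of_le hNpos
          push_cast
          linarith [Nat.cast_nonneg (α := ℝ) j]
        have h0 : 0 ≤ 1 / ((N + j : ℕ) : ℝ) := by positivity
        nlinarith
      · linarith
  have hs : ∀ p ∈ (Finset.Ico N (N + k)).filter Nat.Prime, p.Prime :=
    fun p hp => (Finset.mem_filter.1 hp).2
  refine ⟨∏ p ∈ (Finset.Ico N (N + k)).filter Nat.Prime, p,
    Finset.prod_pos fun p hp => (hs p hp).pos, ?_, ?_⟩
  · refine Nat.Coprime.prod_right fun p hp => ?_
    refine ((hs p hp).coprime_iff_not_dvd.2 fun hdvd => ?_).symm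
    have h1 := Nat.le_of_dvd hm hdvd
    have h2 := (Finset.mem_Ico.1 (Finset.mem_filter.1 hp).1).1
    have h3 : m + 1 ≤ N := le_max_right _ _
    omega
  · rw [totient_prod_primes_div _ hs]
    change |g k - y| < ε
    rw [abs_lt]
    constructor <;> linarith

/-- Assuming Dickson's conjecture, the set `{φ(p+1)/φ(p-1) : p, p+2 both prime}` is dense
in `[0, ∞)`. -/
theorem totient_ratio_twin_dense (hD : DicksonConjecture) :
    ∀ x : ℝ, 0 ≤ x →
      x ∈ closure {r : ℝ | ∃ p : ℕ, Nat.Prime p ∧ Nat.Prime (p + 2) ∧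
        r = (Nat.totient (p + 1) : ℝ) / (Nat.totient (p - 1) : ℝ)} := by
  set S := {r : ℝ | ∃ p : ℕ, Nat.Prime p ∧ Nat.Prime (p + 2) ∧
        r = (Nat.totient (p + 1) : ℝ) / (Nat.totient (p - 1) : ℝ)}
  let V : Set ℝ := {v | ∃ n : ℕ, 0 < n ∧ Nat.Coprime 6 n ∧ v = (n.totient : ℝ) / n}
  have hV : ∀ y : ℝ, 0 < y → y ≤ 1 → y ∈ closure V := by
    intro y hy hy1
    rw [Metric.mem_closure_iff]
    intro ε hε
    obtain ⟨n, hn, hc, hlt⟩ := exists_coprime_totient_div_close (m := 6) (by norm_num) hy hy1 hε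
    exact ⟨_, ⟨n, hn, hc, rfl⟩, by rwa [dist_comm, Real.dist_eq]⟩
  have hdown : ∀ v ∈ V, 2 / 3 * v ∈ closure S := by
    rintro _ ⟨n, hn, hc, rfl⟩
    have h := mem_closure_twin_ratio hD hn one_pos (Nat.coprime_one_right _)
    have hc12 : Nat.Coprime 12 n := by
      have h2 : Nat.Coprime 2 n := Nat.Coprime.coprime_dvd_left (by norm_num) hc
      exact Nat.Coprime.mul_left h2 hc
    rw [Nat.totient_mul hc12, show Nat.totient 12 = 4 from rfl, mul_one,
      show Nat.totient 2 = 1 from rfl] at h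
    convert h using 1
    have : (n : ℝ) ≠ 0 := by positivity
    push_cast
    field_simp
    norm_num
  have hup : ∀ v ∈ V, 2 / 3 * v⁻¹ ∈ closure S := by
    rintro _ ⟨n, hn, hc, rfl⟩
    have h := mem_closure_twin_ratio hD one_pos hn (by simpa using hc)
    have hc2 : Nat.Coprime 2 n := Nat.Coprime.coprime_dvd_left (by norm_num) hc
    rw [Nat.totient_mul hc2, mul_one, show Nat.totient 12 = 4 from rfl,
      show Nat.totient 2 = 1 from rfl] at h
    convert h using 1
    have : (n : ℝ) ≠ 0 := by positivity
    have : (n.totient : ℝ) ≠ 0 := by exact_mod_cast (Nat.totient_pos.2 hn).ne'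
    push_cast
    field_simp
    norm_num
  have hpos : Set.Ioi (0 : ℝ) ⊆ closure S := by
    intro x hx
    have hx : 0 < x := hx
    rcases le_total (3 / 2 * x) 1 with hle | hge
    · have hmem := hV _ (by positivity) hle
      have hcont : ContinuousAt (fun v : ℝ => 2 / 3 * v) (3 / 2 * x) := by fun_prop
      have := hcont.continuousWithinAt.mem_closure hmem hdown
      rw [closure_closure] at this
      convert this using 1
      ring
    · have hmem := hV (3 / 2 * x)⁻¹ (by positivity) (inv_le_one_of_one_le₀ hge)
      have hcont : ContinuousAt (fun v : ℝ => 2 / 3 * v⁻¹) (3 / 2 * x)⁻¹ :=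
        (continuousAt_inv₀ (by positivity)).const_mul _
      have := hcont.continuousWithinAt.mem_closure hmem hup
      rw [closure_closure] at this
      convert this using 1
      rw [inv_inv]
      ring
  intro x hx
  have := closure_minimal hpos isClosed_closure
  rw [closure_Ioi] at this
  exact this hx
end

section
/- The set of real numbers { φ(p+1)/φ(p) : p is prime } is dense in the interval [0, 1/2], i.e., every real number x with 0 ≤ x ≤ 1/2 is a limit point of this set. -/
section

open Filter Topology ArithmeticFunction
open scoped ENNReal

/-- The terms `n⁻ˢ` of the zeta series. -/
noncomputable def zetaTerm (s : ℝ) (n : ℕ) : ℝ≥0∞ := ENNReal.ofReal (1 / (n : ℝ) ^ s)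

/-- The terms `Λ(n) n⁻ˢ` of the Dirichlet series of the von Mangoldt function. -/
noncomputable def mangoldtTerm (s : ℝ) (n : ℕ) : ℝ≥0∞ := ENNReal.ofReal (Λ n / (n : ℝ) ^ s)

/-- The terms `log(n) n⁻ˢ` of the Dirichlet series of the logarithm. -/
noncomputable def logTerm (s : ℝ) (n : ℕ) : ℝ≥0∞ := ENNReal.ofReal (Real.log n / (n : ℝ) ^ s)

lemma zetaTerm_mul (s : ℝ) (m n : ℕ) : zetaTerm s (m * n) = zetaTerm s m * zetaTerm s n := by
  unfold zetaTerm
  rw [← ENNReal.ofReal_mul (by positivity), Nat.cast_mul,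
    Real.mul_rpow (by positivity) (by positivity), div_mul_div_comm, one_mul]

lemma zetaTerm_anti {s : ℝ} (hs : 0 ≤ s) {m n : ℕ} (hm : 0 < m) (hmn : m ≤ n) :
    zetaTerm s n ≤ zetaTerm s m := by
  unfold zetaTerm
  have : (0 : ℝ) < m := by exact_mod_cast hm
  gcongr

lemma sum_divisorsAntidiagonal_mangoldtTerm_mul_zetaTerm (s : ℝ) (n : ℕ) :
    ∑ x ∈ n.divisorsAntidiagonal, mangoldtTerm s x.1 * zetaTerm s x.2 = logTerm s n := by
  have h : ∀ x ∈ n.divisorsAntidiagonal,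
      mangoldtTerm s x.1 * zetaTerm s x.2 = ENNReal.ofReal (Λ x.1 / (n : ℝ) ^ s) := by
    intro x hx
    rw [Nat.mem_divisorsAntidiagonal] at hx
    unfold mangoldtTerm zetaTerm
    rw [← ENNReal.ofReal_mul (div_nonneg vonMangoldt_nonneg (by positivity)), ← hx.1, Nat.cast_mul,
      Real.mul_rpow (by positivity) (by positivity), div_mul_div_comm, mul_one]
  rw [Finset.sum_congr rfl h,
    ← ENNReal.ofReal_sum_of_nonneg fun x _ ↦ div_nonneg vonMangoldt_nonneg (by positivity),
    ← Finset.sum_div, Nat.sum_divisorsAntidiagonal (fun i _ ↦ Λ i), vonMangoldt_sum, logTerm]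

/-- The identity `Λ * 1 = log` for Dirichlet series with arbitrary weights `g(n)`. -/
lemma tsum_mangoldtTerm_mul_zetaTerm {s : ℝ} (hs : s ≠ 0) (g : ℕ → ℝ≥0∞) :
    ∑' d, mangoldtTerm s d * ∑' e, g (d * e) * zetaTerm s e = ∑' n, g n * logTerm s n := by
  have hprod := ENNReal.tsum_prod
    (f := fun d e ↦ g (d * e) * (mangoldtTerm s d * zetaTerm s e))
  have hfib := ENNReal.tsum_fiberwise
    (fun x : ℕ × ℕ ↦ g (x.1 * x.2) * (mangoldtTerm s x.1 * zetaTerm s x.2))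
    (fun x : ℕ × ℕ ↦ x.1 * x.2)
  have : ∀ d, mangoldtTerm s d * ∑' e, g (d * e) * zetaTerm s e =
      ∑' e, g (d * e) * (mangoldtTerm s d * zetaTerm s e) := by
    intro d
    rw [← ENNReal.tsum_mul_left]
    exact tsum_congr fun e ↦ by ring
  rw [tsum_congr this, ← hprod, ← hfib]
  refine tsum_congr fun n ↦ ?_
  have hg : ∀ b : ↑((fun x : ℕ × ℕ ↦ x.1 * x.2) ⁻¹' {n}),
      g ((b : ℕ × ℕ).1 * (b : ℕ × ℕ).2) *
        (mangoldtTerm s (b : ℕ × ℕ).1 * zetaTerm s (b : ℕ × ℕ).2) =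
      g n * (mangoldtTerm s (b : ℕ × ℕ).1 * zetaTerm s (b : ℕ × ℕ).2) := by
    rintro ⟨b, hb⟩
    have hb' : b.1 * b.2 = n := hb
    rw [hb']
  rw [tsum_congr hg, ENNReal.tsum_mul_left]
  congr 1
  rcases eq_or_ne n 0 with rfl | hn
  · rw [ENNReal.tsum_eq_zero.2, logTerm]
    · simp
    · rintro ⟨b, hb⟩
      have hb' : b.1 * b.2 = 0 := hb
      rcases Nat.mul_eq_zero.1 hb' with h | h <;>
        simp [h, mangoldtTerm, zetaTerm, Real.zero_rpow hs]
  · rw [← sum_divisorsAntidiagonal_mangoldtTerm_mul_zetaTerm, ← Finset.tsum_subtype']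
    have : (fun x : ℕ × ℕ ↦ x.1 * x.2) ⁻¹' {n} = ↑n.divisorsAntidiagonal := by
      ext x
      simp [hn]
    rw [this]

lemma tsum_mangoldtTerm_dvd_le {q : ℕ} (hq : q.Prime) {s : ℝ} (hs : 1 ≤ s) :
    ∑' d, (if q ∣ d then mangoldtTerm s d else 0) ≤ ENNReal.ofReal (Real.log q) := by
  have hq2 : (2 : ℝ) ≤ q := by exact_mod_cast hq.two_le
  have hpt : ∀ d, (if q ∣ d then mangoldtTerm s d else 0) ≤
      ∑' k : ℕ, if d = q ^ (k + 1) then ENNReal.ofReal (Real.log q * (1 / 2) ^ (k + 1)) else 0 := by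
    intro d
    split_ifs with hd
    · by_cases hΛ : Λ d = 0
      · simp [mangoldtTerm, hΛ]
      obtain ⟨p, k, hp, hk, rfl⟩ := (isPrimePow_nat_iff _).1 (vonMangoldt_ne_zero_iff.1 hΛ)
      obtain rfl := (Nat.prime_dvd_prime_iff_eq hq hp).1 (hq.dvd_of_dvd_pow hd)
      obtain ⟨k, rfl⟩ := Nat.exists_eq_succ_of_ne_zero hk.ne'
      refine le_trans ?_ (ENNReal.le_tsum k)
      rw [if_pos rfl, mangoldtTerm, vonMangoldt_apply_pow hk.ne', vonMangoldt_apply_prime hq]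
      apply ENNReal.ofReal_le_ofReal
      rw [div_eq_mul_inv]
      have := Real.log_nonneg (x := q) (by linarith)
      gcongr
      rw [one_div, inv_pow]
      gcongr
      calc (2 : ℝ) ^ (k + 1) ≤ (q : ℝ) ^ (k + 1) := by gcongr
        _ = ((q ^ (k + 1) : ℕ) : ℝ) := by push_cast; rfl
        _ ≤ _ := Real.self_le_rpow_of_one_le
          (by exact_mod_cast Nat.one_le_pow _ _ hq.pos) hs
    · positivity
  refine (ENNReal.tsum_le_tsum hpt).trans ?_
  rw [ENNReal.tsum_comm]
  simp only [tsum_ite_eq]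
  rw [← ENNReal.ofReal_tsum_of_nonneg]
  · apply ENNReal.ofReal_le_ofReal
    rw [tsum_mul_left]
    simp only [pow_succ]
    rw [tsum_mul_right, tsum_geometric_two]
    simp
  · intro k
    have := Real.log_nonneg (x := q) (by linarith)
    positivity
  · refine Summable.mul_left _ ?_
    exact (summable_nat_add_iff 1).2 summable_geometric_two

lemma logTerm_anti {s : ℝ} (hs : 1 ≤ s) {m n : ℕ} (hm : 3 ≤ m) (hmn : m ≤ n) :
    logTerm s n ≤ logTerm s m := by
  have he : Real.exp s⁻¹ ≤ m := by
    have h3 : (3 : ℝ) ≤ m := by exact_mod_cast hm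
    have : Real.exp s⁻¹ ≤ Real.exp 1 := Real.exp_le_exp.2 (inv_le_one_of_one_le₀ hs)
    linarith [Real.exp_one_lt_d9]
  have hmn' : (m : ℝ) ≤ n := by exact_mod_cast hmn
  exact ENNReal.ofReal_le_ofReal
    (Real.log_div_self_rpow_antitoneOn (by linarith) he (he.trans hmn') hmn')

lemma logTerm_mul_le {s : ℝ} {m n : ℕ} (hm : 0 < m) (hn : 0 < n) :
    logTerm s (m * n) ≤
      zetaTerm s n * (ENNReal.ofReal (Real.log n) * zetaTerm s m + logTerm s m) := by
  have hm1 : (1 : ℝ) ≤ m := by exact_mod_cast hm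
  have hn1 : (1 : ℝ) ≤ n := by exact_mod_cast hn
  have h1 := Real.log_nonneg hm1
  have h2 := Real.log_nonneg hn1
  unfold logTerm zetaTerm
  rw [← ENNReal.ofReal_mul h2, ← ENNReal.ofReal_add (by positivity) (by positivity),
    ← ENNReal.ofReal_mul (by positivity)]
  apply ENNReal.ofReal_le_ofReal
  rw [Nat.cast_mul, Real.mul_rpow (by positivity) (by positivity),
    Real.log_mul (by positivity) (by positivity)]
  apply le_of_eq
  field_simp
  ring

lemma tsum_logTerm_neg_one_le {q : ℕ} (hq : 3 ≤ q) {s : ℝ} (hs : 1 ≤ s) :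
    ∑' n : ℕ, (if (n : ZMod q) = -1 then 1 else 0) * logTerm s n ≤
      logTerm s (q - 1) + zetaTerm s q *
        (ENNReal.ofReal (Real.log q) * ∑' n, zetaTerm s n + ∑' n, logTerm s n) := by
  have hinj : Function.Injective fun j : ℕ ↦ j * q + (q - 1) := fun i j h ↦ by
    simpa [show q ≠ 0 by omega] using h
  have hsupp : (Function.support fun n : ℕ ↦
      (if (n : ZMod q) = -1 then 1 else 0) * logTerm s n) ⊆
      Set.range fun j : ℕ ↦ j * q + (q - 1) := by
    intro n hn
    have hn' : (n : ZMod q) = -1 := by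
      by_contra h
      simp [h] at hn
    have hd : q ∣ n + 1 := by
      rw [← ZMod.natCast_eq_zero_iff]
      simp [hn']
    obtain ⟨c, hc⟩ := hd
    have hc0 : c ≠ 0 := by rintro rfl; simp at hc
    obtain ⟨j, rfl⟩ := Nat.exists_eq_succ_of_ne_zero hc0
    refine ⟨j, ?_⟩
    have : q * (j + 1) = j * q + q := by ring
    simp only
    rw [Nat.succ_eq_add_one] at hc
    omega
  rw [← hinj.tsum_eq hsupp, tsum_eq_zero_add' ENNReal.summable]
  refine add_le_add ?_ ?_
  · simp only [zero_mul, zero_add]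
    split_ifs <;> simp
  · rw [← ENNReal.tsum_mul_left, ← ENNReal.tsum_add, ← ENNReal.tsum_mul_left]
    refine le_trans ?_ (ENNReal.tsum_comp_le_tsum_of_injective (Nat.succ_injective) _)
    refine ENNReal.tsum_le_tsum fun j ↦ ?_
    refine le_trans ?_ (logTerm_mul_le j.succ_pos (by omega))
    refine le_trans ?_ (logTerm_anti hs (n := (j + 1) * q + (q - 1)) ?_ ?_)
    · split_ifs <;> simp
    · nlinarith
    · exact Nat.le_add_right _ _

/-- A lower bound for the zeta series over the residue class of `-d⁻¹` modulo `q`. -/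
lemma le_tsum_zetaTerm_neg_one {q : ℕ} [Fact q.Prime] {s : ℝ} (hs : 0 ≤ s) (d : ℕ) :
    (if (d : ZMod q) = -1 then 1 else 0) +
      (if q ∣ d then 0 else 1) * ∑' j : ℕ, zetaTerm s ((j + 2) * q) ≤
    ∑' e : ℕ, (if ((d * e : ℕ) : ZMod q) = -1 then 1 else 0) * zetaTerm s e := by
  have hqp : q.Prime := Fact.out
  by_cases hd : q ∣ d
  · have h0 : (d : ZMod q) = 0 := (ZMod.natCast_eq_zero_iff _ _).2 hd
    simp [hd, h0]
  have h0 : (d : ZMod q) ≠ 0 := fun h ↦ hd ((ZMod.natCast_eq_zero_iff _ _).1 h)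
  set r : ℕ := (-(d : ZMod q)⁻¹).val with hr
  have hrq : r < q := ZMod.val_lt _
  have hmul : ∀ j : ℕ, ((d * (j * q + r) : ℕ) : ZMod q) = -1 := by
    intro j
    push_cast
    rw [hr, ZMod.natCast_zmod_val]
    simp [h0]
  have hinj : Function.Injective fun j : ℕ ↦ j * q + r := fun i j h ↦ by
    simpa [hqp.ne_zero] using h
  refine le_trans ?_ (ENNReal.tsum_comp_le_tsum_of_injective hinj _)
  simp only [hmul, if_true, one_mul, if_neg hd]
  rw [tsum_eq_zero_add' (f := fun j : ℕ ↦ zetaTerm s (j * q + r)) ENNReal.summable]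
  refine add_le_add ?_ (ENNReal.tsum_le_tsum fun j ↦ ?_)
  · split_ifs with h1
    · have : r = 1 := by
        rw [hr, h1]
        have : Fact (1 < q) := ⟨hqp.one_lt⟩
        simp [inv_neg, ZMod.val_one]
      simp [this, zetaTerm]
    · positivity
  · apply zetaTerm_anti hs
    · have := hqp.pos
      have := hinj.ne (a₁ := 1) (a₂ := 0) (by simp)
      positivity
    · nlinarith

lemma tsum_zetaTerm_mul {s : ℝ} (hs : s ≠ 0) (q : ℕ) :
    zetaTerm s q * ∑' n, zetaTerm s n = zetaTerm s q + ∑' j : ℕ, zetaTerm s ((j + 2) * q) := by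
  have h0 : zetaTerm s 0 = 0 := by simp [zetaTerm, Real.zero_rpow hs]
  have h1 : zetaTerm s 1 = 1 := by simp [zetaTerm]
  rw [tsum_eq_zero_add' ENNReal.summable, h0, zero_add, tsum_eq_zero_add' ENNReal.summable,
    zero_add, h1, mul_add, mul_one, ← ENNReal.tsum_mul_left]
  congr 1
  exact tsum_congr fun j ↦ by rw [zetaTerm_mul, mul_comm]

lemma tsum_mangoldtTerm_neg_one_le {q : ℕ} [Fact q.Prime] (hq : 3 ≤ q) {s : ℝ} (hs : 1 ≤ s)
    (hZ : ∑' n, zetaTerm s n ≠ ⊤) (hL : ∑' n, mangoldtTerm s n ≠ ⊤) :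
    ∑' n : ℕ, (if (n : ZMod q) = -1 then mangoldtTerm s n else 0) ≤
      logTerm s (q - 1) + zetaTerm s q *
        (2 * (ENNReal.ofReal (Real.log q) * ∑' n, zetaTerm s n) + ∑' n, mangoldtTerm s n) := by
  have hqp : q.Prime := Fact.out
  have hs0 : s ≠ 0 := by linarith
  set Z := ∑' n, zetaTerm s n with hZdef
  set L := ∑' n, mangoldtTerm s n with hLdef
  set Y := ∑' j : ℕ, zetaTerm s ((j + 2) * q) with hY
  set T := ∑' n : ℕ, (if (n : ZMod q) = -1 then mangoldtTerm s n else 0) with hT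
  set Ld := ∑' d, (if q ∣ d then mangoldtTerm s d else 0) with hLd
  set Lc := ∑' d, (if q ∣ d then 0 else mangoldtTerm s d) with hLc
  have hW : ∑' n, logTerm s n = L * Z := by
    have := tsum_mangoldtTerm_mul_zetaTerm hs0 (fun _ ↦ 1)
    simp only [one_mul] at this
    rw [← this, ENNReal.tsum_mul_right]
  have hsplit : L = Ld + Lc := by
    rw [hLdef, hLd, hLc, ← ENNReal.tsum_add]
    exact tsum_congr fun d ↦ by split_ifs <;> simp
  have hzZ : zetaTerm s q * Z = zetaTerm s q + Y := tsum_zetaTerm_mul hs0 q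
  have hLd_le : Ld ≤ ENNReal.ofReal (Real.log q) := tsum_mangoldtTerm_dvd_le hqp hs
  have hlower : T + Lc * Y ≤
      ∑' n : ℕ, (if (n : ZMod q) = -1 then 1 else 0) * logTerm s n := by
    rw [← tsum_mangoldtTerm_mul_zetaTerm hs0, hT, hLc, ← ENNReal.tsum_mul_right, ← ENNReal.tsum_add]
    refine ENNReal.tsum_le_tsum fun d ↦ ?_
    refine le_trans (le_of_eq ?_) (mul_le_mul_right (le_tsum_zetaTerm_neg_one (by linarith) d) _)
    rw [← hY]
    split_ifs <;> simp [mul_add]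
  have hYZ : Y ≤ zetaTerm s q * Z := hzZ ▸ le_add_self
  have hfin : Lc * Y ≠ ⊤ :=
    ENNReal.mul_ne_top (ne_top_of_le_ne_top hL (hsplit ▸ le_add_self))
      (ne_top_of_le_ne_top (ENNReal.mul_ne_top ENNReal.ofReal_ne_top hZ) hYZ)
  refine (ENNReal.add_le_add_iff_right hfin).1 ?_
  calc T + Lc * Y ≤ logTerm s (q - 1) + zetaTerm s q *
        (ENNReal.ofReal (Real.log q) * Z + L * Z) := by
        rw [← hW]
        exact hlower.trans (tsum_logTerm_neg_one_le hq hs)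
    _ = logTerm s (q - 1) + (zetaTerm s q * (ENNReal.ofReal (Real.log q) * Z + L) +
        Ld * Y) + Lc * Y := by
        rw [show zetaTerm s q * (ENNReal.ofReal (Real.log q) * Z + L * Z) =
          zetaTerm s q * (ENNReal.ofReal (Real.log q) * Z) + L * (zetaTerm s q * Z) by ring, hzZ]
        have : L * (zetaTerm s q + Y) = zetaTerm s q * L + (Ld * Y + Lc * Y) := by
          rw [← add_mul, ← hsplit]
          ring
        rw [this]
        ring
    _ ≤ logTerm s (q - 1) + (zetaTerm s q * (ENNReal.ofReal (Real.log q) * Z + L) +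
        ENNReal.ofReal (Real.log q) * (zetaTerm s q * Z)) + Lc * Y := by gcongr
    _ = _ := by ring

lemma summable_vonMangoldt_div_rpow {s : ℝ} (hs : 1 < s) :
    Summable fun n : ℕ ↦ Λ n / (n : ℝ) ^ s := by
  have h := LSeries.summable_real_of_abscissaOfAbsConv_lt
    ((vonMangoldt.abscissaOfAbsConv_residueClass_le_one (0 : ZMod 1)).trans_lt
      (show (1 : EReal) < s by exact_mod_cast hs))
  refine h.congr fun n ↦ ?_
  rw [vonMangoldt.residueClass, Set.indicator_of_mem]
  exact Subsingleton.elim _ _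

/-- An upper bound of Chebyshev type for the primes congruent to `-1` modulo `q`. -/
lemma tsum_residueClass_neg_one_le {q : ℕ} (hqp : q.Prime) (hq : 3 ≤ q) {s : ℝ} (hs : 1 < s) :
    ∑' n : ℕ, vonMangoldt.residueClass (-1 : ZMod q) n / (n : ℝ) ^ s ≤
      Real.log q / q * (2 + 2 * ∑' n : ℕ, 1 / (n : ℝ) ^ s + ∑' n : ℕ, Λ n / (n : ℝ) ^ s) := by
  have : Fact q.Prime := ⟨hqp⟩
  have hZs : Summable fun n : ℕ ↦ 1 / (n : ℝ) ^ s := Real.summable_one_div_nat_rpow.2 hs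
  have hLs := summable_vonMangoldt_div_rpow hs
  have hZ0 : ∀ n : ℕ, 0 ≤ 1 / (n : ℝ) ^ s := fun n ↦ by positivity
  have hL0 : ∀ n : ℕ, 0 ≤ Λ n / (n : ℝ) ^ s :=
    fun n ↦ div_nonneg vonMangoldt_nonneg (by positivity)
  have hZ : ∑' n, zetaTerm s n = ENNReal.ofReal (∑' n : ℕ, 1 / (n : ℝ) ^ s) :=
    (ENNReal.ofReal_tsum_of_nonneg hZ0 hZs).symm
  have hL : ∑' n, mangoldtTerm s n = ENNReal.ofReal (∑' n : ℕ, Λ n / (n : ℝ) ^ s) :=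
    (ENNReal.ofReal_tsum_of_nonneg hL0 hLs).symm
  have hZ0' : 0 ≤ ∑' n : ℕ, 1 / (n : ℝ) ^ s := tsum_nonneg hZ0
  have hL0' : 0 ≤ ∑' n : ℕ, Λ n / (n : ℝ) ^ s := tsum_nonneg hL0
  have h := tsum_mangoldtTerm_neg_one_le hq hs.le
    (hZ ▸ ENNReal.ofReal_ne_top) (hL ▸ ENNReal.ofReal_ne_top)
  have hq3 : (3 : ℝ) ≤ q := by exact_mod_cast hq
  have hlog : 1 ≤ Real.log q := by
    rw [Real.le_log_iff_exp_le (by linarith)]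
    linarith [Real.exp_one_lt_d9]
  have hT0 : ∀ n : ℕ, 0 ≤ vonMangoldt.residueClass (-1 : ZMod q) n / (n : ℝ) ^ s :=
    fun n ↦ div_nonneg (vonMangoldt.residueClass_nonneg _ n) (by positivity)
  have hTs : Summable fun n : ℕ ↦ vonMangoldt.residueClass (-1 : ZMod q) n / (n : ℝ) ^ s :=
    hLs.of_nonneg_of_le hT0 fun n ↦ by
      gcongr
      exact vonMangoldt.residueClass_le _ n
  have hT : ∑' n : ℕ, (if (n : ZMod q) = -1 then mangoldtTerm s n else 0) =
      ENNReal.ofReal (∑' n : ℕ, vonMangoldt.residueClass (-1 : ZMod q) n / (n : ℝ) ^ s) := by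
    rw [ENNReal.ofReal_tsum_of_nonneg hT0 hTs]
    refine tsum_congr fun n ↦ ?_
    by_cases hn : (n : ZMod q) = -1 <;>
      simp [vonMangoldt.residueClass, Set.indicator, hn, mangoldtTerm]
  have hlogq : Real.log ((q - 1 : ℕ) : ℝ) / ((q - 1 : ℕ) : ℝ) ^ s ≤ Real.log q / q * 2 := by
    have hc : ((q - 1 : ℕ) : ℝ) = q - 1 := by rw [Nat.cast_sub (by omega)]; simp
    rw [hc, div_mul_eq_mul_div, div_le_div_iff₀ (Real.rpow_pos_of_pos (by linarith) _) (by linarith)]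
    have h1 : Real.log (q - 1 : ℝ) ≤ Real.log q :=
      Real.log_le_log (by linarith) (by linarith)
    have h2 : (q - 1 : ℝ) ≤ (q - 1 : ℝ) ^ s := Real.self_le_rpow_of_one_le (by linarith) hs.le
    nlinarith
  have hzq : 1 / (q : ℝ) ^ s ≤ 1 / q := by
    have := Real.self_le_rpow_of_one_le (x := (q : ℝ)) (by linarith) hs.le
    gcongr
  rw [hT, hL, hZ] at h
  set Z := ∑' n : ℕ, 1 / (n : ℝ) ^ s
  set L := ∑' n : ℕ, Λ n / (n : ℝ) ^ s
  have hl0 : 0 ≤ Real.log ((q - 1 : ℕ) : ℝ) / ((q - 1 : ℕ) : ℝ) ^ s := by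
    have := Real.log_natCast_nonneg (q - 1)
    positivity
  have h' : zetaTerm s q * (2 * (ENNReal.ofReal (Real.log q) * ENNReal.ofReal Z) +
      ENNReal.ofReal L) = ENNReal.ofReal (1 / (q : ℝ) ^ s * (2 * (Real.log q * Z) + L)) := by
    rw [ENNReal.ofReal_mul (by positivity), ENNReal.ofReal_add (by positivity) hL0',
      ENNReal.ofReal_mul (by positivity), ENNReal.ofReal_mul (by positivity), zetaTerm]
    simp
  rw [h', logTerm, ← ENNReal.ofReal_add hl0 (by positivity),
    ENNReal.ofReal_le_ofReal_iff (by positivity)] at h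
  calc _ ≤ _ := h
    _ ≤ Real.log q / q * 2 + 1 / q * (2 * (Real.log q * Z) + L) := by gcongr
    _ ≤ Real.log q / q * 2 + 1 / q * (2 * (Real.log q * Z) + Real.log q * L) := by
        gcongr
        nlinarith
    _ = _ := by ring

lemma tsum_residueClass_eq_aux {q : ℕ} [NeZero q] {a : ZMod q} (ha : IsUnit a) {x : ℝ}
    (hx : 1 < x) : ∑' n : ℕ, vonMangoldt.residueClass a n / (n : ℝ) ^ x =
      (vonMangoldt.LFunctionResidueClassAux a x).re + (q.totient : ℝ)⁻¹ / (x - 1) := by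
  refine Complex.ofReal_injective ?_
  simp only [Complex.ofReal_tsum, Complex.ofReal_div, Complex.ofReal_cpow (Nat.cast_nonneg _),
    Complex.ofReal_natCast, Complex.ofReal_add, Complex.ofReal_inv, Complex.ofReal_sub,
    Complex.ofReal_one]
  simp_rw [← vonMangoldt.LFunctionResidueClassAux_real ha hx,
    vonMangoldt.eqOn_LFunctionResidueClassAux ha <| Set.mem_ofPred.mpr (Complex.ofReal_re x ▸ hx),
    sub_add_cancel, LSeries, LSeries.term]
  refine tsum_congr fun n ↦ ?_
  split_ifs with hn
  · simp only [hn, vonMangoldt.residueClass_apply_zero, Complex.ofReal_zero, zero_div]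
  · rfl

lemma tendsto_sub_mul_tsum_residueClass {q : ℕ} [NeZero q] {a : ZMod q} (ha : IsUnit a) :
    Tendsto (fun s : ℝ ↦ (s - 1) * ∑' n : ℕ, vonMangoldt.residueClass a n / (n : ℝ) ^ s)
      (𝓝[>] 1) (𝓝 (q.totient : ℝ)⁻¹) := by
  have hcont : ContinuousOn (fun x : ℝ ↦ (vonMangoldt.LFunctionResidueClassAux a x).re)
      (Set.Ici 1) :=
    Complex.continuous_re.continuousOn.comp (t := Set.univ)
      (vonMangoldt.continuousOn_LFunctionResidueClassAux a) (fun ⦃x⦄ _ ↦ trivial) |>.comp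
      Complex.continuous_ofReal.continuousOn fun x hx ↦ by
        simpa only [Set.mem_ofPred_eq, Complex.ofReal_re] using Set.mem_Ici.1 hx
  have hlim := (hcont 1 Set.self_mem_Ici).mono (Set.Ioi_subset_Ici_self)
  have hsub : Tendsto (fun s : ℝ ↦ s - 1) (𝓝[>] 1) (𝓝 0) := by
    have : Tendsto (fun s : ℝ ↦ s - 1) (𝓝 1) (𝓝 (1 - 1)) := tendsto_id.sub_const 1
    simpa using this.mono_left nhdsWithin_le_nhds
  have := (hsub.mul hlim).add_const (q.totient : ℝ)⁻¹
  rw [zero_mul, zero_add] at this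
  refine this.congr' ?_
  filter_upwards [self_mem_nhdsWithin] with s hs
  have hs' : s - 1 ≠ 0 := sub_ne_zero.2 (ne_of_gt hs)
  rw [tsum_residueClass_eq_aux ha hs]
  field_simp

lemma tendsto_sub_mul_tsum_vonMangoldt :
    Tendsto (fun s : ℝ ↦ (s - 1) * ∑' n : ℕ, Λ n / (n : ℝ) ^ s) (𝓝[>] 1) (𝓝 1) := by
  have h := tendsto_sub_mul_tsum_residueClass (q := 1) (a := 0) (isUnit_of_subsingleton _)
  simp only [Nat.totient_one, Nat.cast_one, inv_one] at h
  refine h.congr fun s ↦ ?_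
  congr 1
  refine tsum_congr fun n ↦ ?_
  rw [vonMangoldt.residueClass, Set.indicator_of_mem]
  exact Subsingleton.elim _ _

/-- The Dirichlet series of the von Mangoldt function over `n ≡ a` modulo `Q` with `r ∣ n + 1`. -/
noncomputable def shiftedSum {Q : ℕ} (a : ZMod Q) (r : ℕ) (s : ℝ) : ℝ :=
  ∑' n : ℕ, if r ∣ n + 1 then vonMangoldt.residueClass a n / (n : ℝ) ^ s else 0

section shiftedSum

variable {Q : ℕ} (a : ZMod Q)

lemma residueClass_div_nonneg (n : ℕ) (s : ℝ) :
    0 ≤ vonMangoldt.residueClass a n / (n : ℝ) ^ s :=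
  div_nonneg (vonMangoldt.residueClass_nonneg a n) (by positivity)

lemma summable_residueClass_div {s : ℝ} (hs : 1 < s) :
    Summable fun n : ℕ ↦ vonMangoldt.residueClass a n / (n : ℝ) ^ s :=
  (summable_vonMangoldt_div_rpow hs).of_nonneg_of_le (residueClass_div_nonneg a · s) fun n ↦ by
    gcongr
    exact vonMangoldt.residueClass_le a n

lemma summable_shiftedSum (r : ℕ) {s : ℝ} (hs : 1 < s) :
    Summable fun n : ℕ ↦ if r ∣ n + 1 then vonMangoldt.residueClass a n / (n : ℝ) ^ s else 0 :=
  (summable_residueClass_div a hs).of_nonneg_of_le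
    (fun n ↦ by split_ifs; exacts [residueClass_div_nonneg a n s, le_rfl])
    (fun n ↦ by split_ifs; exacts [le_rfl, residueClass_div_nonneg a n s])

lemma shiftedSum_nonneg (r : ℕ) (s : ℝ) : 0 ≤ shiftedSum a r s :=
  tsum_nonneg fun n ↦ by split_ifs; exacts [residueClass_div_nonneg a n s, le_rfl]

lemma dvd_succ_iff_cast_eq_neg_one {r n : ℕ} : r ∣ n + 1 ↔ (n : ZMod r) = -1 := by
  rw [← ZMod.natCast_eq_zero_iff, Nat.cast_add, Nat.cast_one, eq_neg_iff_add_eq_zero]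

lemma shiftedSum_le {r : ℕ} (hr : r.Prime) (hr3 : 3 ≤ r) {s : ℝ} (hs : 1 < s) :
    shiftedSum a r s ≤
      Real.log r / r * (2 + 2 * ∑' n : ℕ, 1 / (n : ℝ) ^ s + ∑' n : ℕ, Λ n / (n : ℝ) ^ s) := by
  refine le_trans ?_ (tsum_residueClass_neg_one_le hr hr3 hs)
  refine (summable_shiftedSum a r hs).tsum_le_tsum (fun n ↦ ?_) (summable_residueClass_div _ hs)
  split_ifs with h
  · have : vonMangoldt.residueClass (-1 : ZMod r) n = Λ n :=
      Set.indicator_of_mem (s := {n : ℕ | (n : ZMod r) = -1}) (dvd_succ_iff_cast_eq_neg_one.1 h) _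
    rw [this]
    gcongr
    exact vonMangoldt.residueClass_le a n
  · exact residueClass_div_nonneg _ n s

lemma tendsto_shiftedSum [NeZero Q] {a : ZMod Q} (ha : IsUnit a) {r : ℕ} (hr : r.Prime)
    (hQr : Q.Coprime r) :
    Tendsto (fun s : ℝ ↦ (s - 1) * shiftedSum a r s) (𝓝[>] 1)
      (𝓝 ((Q.totient : ℝ)⁻¹ * ((r : ℝ) - 1)⁻¹)) := by
  have : NeZero (Q * r) := ⟨mul_ne_zero (NeZero.ne Q) hr.ne_zero⟩
  set b : ZMod (Q * r) := (ZMod.chineseRemainder hQr).symm (a, -1) with hb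
  have hbu : IsUnit b := by
    have : IsUnit ((a, -1) : ZMod Q × ZMod r) := Prod.isUnit_iff.2 ⟨ha, isUnit_one.neg⟩
    exact this.map (ZMod.chineseRemainder hQr).symm
  have hlim := tendsto_sub_mul_tsum_residueClass hbu
  have ht : ((Q * r).totient : ℝ)⁻¹ = (Q.totient : ℝ)⁻¹ * ((r : ℝ) - 1)⁻¹ := by
    rw [Nat.totient_mul hQr, Nat.totient_prime hr, Nat.cast_mul, Nat.cast_sub hr.one_le,
      Nat.cast_one, mul_inv]
  rw [ht] at hlim
  refine hlim.congr fun s ↦ ?_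
  congr 1
  refine tsum_congr fun n ↦ ?_
  have hiff : (n : ZMod (Q * r)) = b ↔ (n : ZMod Q) = a ∧ (n : ZMod r) = -1 := by
    rw [hb, RingEquiv.eq_symm_apply, map_natCast, Prod.ext_iff]
    simp
  by_cases h1 : (n : ZMod Q) = a <;> by_cases h2 : (n : ZMod r) = -1 <;>
    simp [dvd_succ_iff_cast_eq_neg_one, vonMangoldt.residueClass, Set.indicator, hiff, h1, h2]

end shiftedSum

lemma summable_log_div_sq : Summable fun n : ℕ ↦ Real.log n / (n : ℝ) ^ 2 := by
  have h : Summable fun n : ℕ ↦ 2 * (1 / (n : ℝ) ^ (3 / 2 : ℝ)) :=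
    (Real.summable_one_div_nat_rpow.2 (by norm_num)).mul_left 2
  refine h.of_nonneg_of_le
    (fun n ↦ div_nonneg (Real.log_natCast_nonneg n) (by positivity)) fun n ↦ ?_
  rcases n.eq_zero_or_pos with rfl | hn
  · simp
  have hn' : (0 : ℝ) < n := by exact_mod_cast hn
  have := Real.log_le_rpow_div hn'.le (show (0 : ℝ) < 1 / 2 by norm_num)
  rw [mul_one_div, div_le_div_iff₀ (by positivity) (by positivity)]
  calc Real.log n * (n : ℝ) ^ (3 / 2 : ℝ)
      ≤ ((n : ℝ) ^ (1 / 2 : ℝ) / (1 / 2)) * (n : ℝ) ^ (3 / 2 : ℝ) := by gcongr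
    _ = 2 * ((n : ℝ) ^ (1 / 2 : ℝ) * (n : ℝ) ^ (3 / 2 : ℝ)) := by ring
    _ = 2 * (n : ℝ) ^ 2 := by
        rw [← Real.rpow_add hn', ← Real.rpow_natCast]
        norm_num

lemma tsum_inv_mul_pred_le {k : ℕ} (hk : 0 < k) :
    ∑' r : ℕ, (if r.Prime ∧ k < r then (r : ℝ)⁻¹ * ((r : ℝ) - 1)⁻¹ else 0) ≤ 1 / k := by
  have hnn : ∀ r : ℕ, 0 ≤ (if r.Prime ∧ k < r then (r : ℝ)⁻¹ * ((r : ℝ) - 1)⁻¹ else 0) := by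
    intro r
    split_ifs with h
    · have : (1 : ℝ) ≤ r := by exact_mod_cast h.1.one_le
      have : 0 ≤ (r : ℝ) - 1 := by linarith
      positivity
    · exact le_rfl
  refine Real.tsum_le_of_sum_range_le hnn fun n ↦ ?_
  have hk' : (0 : ℝ) < k := by exact_mod_cast hk
  have key : ∀ m : ℕ, ∑ r ∈ Finset.range (m + 1 + k),
      (if r.Prime ∧ k < r then (r : ℝ)⁻¹ * ((r : ℝ) - 1)⁻¹ else 0) ≤ 1 / k - 1 / (m + k) := by
    intro m
    induction m with
    | zero =>
      rw [Finset.sum_eq_zero]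
      · simp
      · intro r hr
        rw [Finset.mem_range] at hr
        rw [if_neg (by omega)]
    | succ m ih =>
      rw [show m + 1 + 1 + k = (m + 1 + k) + 1 by ring, Finset.sum_range_succ]
      have : (if (m + 1 + k).Prime ∧ k < m + 1 + k then
          ((m + 1 + k : ℕ) : ℝ)⁻¹ * (((m + 1 + k : ℕ) : ℝ) - 1)⁻¹ else 0) ≤
          1 / (m + k) - 1 / ((m + 1 : ℕ) + k) := by
        have e : 1 / ((m : ℝ) + k) - 1 / ((m + 1 : ℕ) + k) =
            ((m + 1 + k : ℕ) : ℝ)⁻¹ * (((m + 1 + k : ℕ) : ℝ) - 1)⁻¹ := by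
          push_cast
          rw [show (m : ℝ) + 1 + k - 1 = m + k by ring]
          field_simp
          ring
        rw [e]
        split_ifs
        · exact le_rfl
        · rw [← e, sub_nonneg]
          push_cast
          gcongr
          linarith
      linarith
  calc _ ≤ ∑ r ∈ Finset.range (n + 1 + k),
      (if r.Prime ∧ k < r then (r : ℝ)⁻¹ * ((r : ℝ) - 1)⁻¹ else 0) :=
        Finset.sum_le_sum_of_subset_of_nonneg (Finset.range_mono (by omega)) fun r _ _ ↦ hnn r
    _ ≤ _ := key n
    _ ≤ _ := sub_le_self _ (by positivity)

/-- The limit as `s → 1⁺` may be taken termwise in the sum of `shiftedSum a r s / r` over the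
primes `r > k`. -/
lemma tendsto_tsum_shiftedSum {Q : ℕ} [NeZero Q] {a : ZMod Q} (ha : IsUnit a) {k : ℕ} (hk : 2 ≤ k)
    (hQ : ∀ r : ℕ, r.Prime → k < r → Q.Coprime r) :
    Tendsto (fun s : ℝ ↦ ∑' r : ℕ,
        if r.Prime ∧ k < r then (s - 1) * ((r : ℝ)⁻¹ * shiftedSum a r s) else 0) (𝓝[>] 1)
      (𝓝 ((Q.totient : ℝ)⁻¹ *
        ∑' r : ℕ, if r.Prime ∧ k < r then (r : ℝ)⁻¹ * ((r : ℝ) - 1)⁻¹ else 0)) := by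
  have hsub : Tendsto (fun s : ℝ ↦ s - 1) (𝓝[>] 1) (𝓝 0) := by
    have : Tendsto (fun s : ℝ ↦ s - 1) (𝓝 1) (𝓝 (1 - 1)) := tendsto_id.sub_const 1
    simpa using this.mono_left nhdsWithin_le_nhds
  have hbd : Tendsto (fun s : ℝ ↦ (s - 1) *
      (2 + 2 * ∑' n : ℕ, 1 / (n : ℝ) ^ s + ∑' n : ℕ, Λ n / (n : ℝ) ^ s)) (𝓝[>] 1) (𝓝 3) := by
    have := ((hsub.const_mul 2).add (tendsto_sub_mul_tsum_nat_rpow.const_mul 2)).add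
      tendsto_sub_mul_tsum_vonMangoldt
    norm_num at this
    refine this.congr fun s ↦ ?_
    ring_nf
  rw [← tsum_mul_left]
  refine tendsto_tsum_of_dominated_convergence (summable_log_div_sq.mul_left 4) (fun r ↦ ?_) ?_
  · split_ifs with h
    · convert (tendsto_shiftedSum ha h.1 (hQ r h.1 h.2)).const_mul (r : ℝ)⁻¹ using 2 <;> ring
    · simp
  · filter_upwards [self_mem_nhdsWithin, hbd.eventually_le_const (show (3 : ℝ) < 4 by norm_num)]
      with s hs hs4 r
    have hs0 : 0 ≤ s - 1 := sub_nonneg.2 (le_of_lt hs)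
    have hlog := Real.log_natCast_nonneg r
    split_ifs with h
    · have hS := shiftedSum_nonneg a r s
      rw [Real.norm_of_nonneg (by positivity)]
      calc (s - 1) * ((r : ℝ)⁻¹ * shiftedSum a r s)
          ≤ (s - 1) * ((r : ℝ)⁻¹ * (Real.log r / r *
            (2 + 2 * ∑' n : ℕ, 1 / (n : ℝ) ^ s + ∑' n : ℕ, Λ n / (n : ℝ) ^ s))) := by
            gcongr
            exact shiftedSum_le a h.1 (by omega) hs
        _ = ((s - 1) * (2 + 2 * ∑' n : ℕ, 1 / (n : ℝ) ^ s + ∑' n : ℕ, Λ n / (n : ℝ) ^ s)) *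
            (Real.log r / (r : ℝ) ^ 2) := by
            field_simp
        _ ≤ _ := by gcongr
    · rw [norm_zero]
      positivity

lemma summable_inv_mul_shiftedSum {Q : ℕ} (a : ZMod Q) {k : ℕ} (hk : 2 ≤ k) {s : ℝ} (hs : 1 < s) :
    Summable fun r : ℕ ↦ if r.Prime ∧ k < r then (r : ℝ)⁻¹ * shiftedSum a r s else 0 := by
  refine (summable_log_div_sq.mul_right
    (2 + 2 * ∑' n : ℕ, 1 / (n : ℝ) ^ s + ∑' n : ℕ, Λ n / (n : ℝ) ^ s)).of_nonneg_of_le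
    (fun r ↦ ?_) fun r ↦ ?_
  · have := shiftedSum_nonneg a r s
    split_ifs <;> positivity
  · split_ifs with h
    · refine (mul_le_mul_of_nonneg_left (shiftedSum_le a h.1 (by omega) hs)
        (by positivity)).trans (le_of_eq ?_)
      field_simp
    · have h1 : 0 ≤ ∑' n : ℕ, 1 / (n : ℝ) ^ s := tsum_nonneg fun n ↦ by positivity
      have h2 : 0 ≤ ∑' n : ℕ, Λ n / (n : ℝ) ^ s :=
        tsum_nonneg fun n ↦ div_nonneg vonMangoldt_nonneg (by positivity)
      have := Real.log_natCast_nonneg r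
      positivity

/-- There is a prime `p ≡ a` modulo `Q` such that the reciprocals of the prime factors of `p + 1`
exceeding `k` have small sum. -/
lemma exists_prime_sum_inv_lt {Q : ℕ} [NeZero Q] {a : ZMod Q} (ha : IsUnit a) {k : ℕ} (hk : 2 ≤ k)
    (hQ : ∀ r : ℕ, r.Prime → k < r → Q.Coprime r) {ε : ℝ} (hε : 1 / k < ε) :
    ∃ p : ℕ, p.Prime ∧ (p : ZMod Q) = a ∧
      ∑ r ∈ (p + 1).primeFactors with k < r, (r : ℝ)⁻¹ < ε := by
  by_contra! H
  have hε0 : 0 < ε := lt_of_le_of_lt (by positivity) hε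
  set C : ℝ := ∑' n : ℕ, (if n.Prime then 0 else vonMangoldt.residueClass a n) / (n : ℝ) with hC
  have hprimes : ∀ s : ℝ, 1 < s →
      ∑' n : ℕ, ε * (if n.Prime then vonMangoldt.residueClass a n / (n : ℝ) ^ s else 0) ≤
      ∑' r : ℕ, if r.Prime ∧ k < r then (r : ℝ)⁻¹ * shiftedSum a r s else 0 := by
    intro s hs
    refine Real.tsum_le_of_sum_range_le (fun n ↦ ?_) fun N ↦ ?_
    · have := residueClass_div_nonneg a n s
      split_ifs <;> positivity
    calc _ ≤ ∑ n ∈ Finset.range N, ∑ r ∈ Finset.range (N + 1), (if r.Prime ∧ k < r then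
          (r : ℝ)⁻¹ * (if r ∣ n + 1 then vonMangoldt.residueClass a n / (n : ℝ) ^ s else 0)
          else 0) := by
          refine Finset.sum_le_sum fun n hn ↦ ?_
          rw [Finset.mem_range] at hn
          have hnn := residueClass_div_nonneg a n s
          have hr0 : ∀ r : ℕ, 0 ≤ (if r.Prime ∧ k < r then
            (r : ℝ)⁻¹ * (if r ∣ n + 1 then vonMangoldt.residueClass a n / (n : ℝ) ^ s else 0)
            else 0) := fun r ↦ by split_ifs <;> positivity
          by_cases hna : n.Prime ∧ (n : ZMod Q) = a
          · rw [if_pos hna.1]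
            refine (mul_le_mul_of_nonneg_right (H n hna.1 hna.2) hnn).trans ?_
            rw [Finset.sum_mul]
            refine le_trans (le_of_eq ?_) (Finset.sum_le_sum_of_subset_of_nonneg
              (s := (n + 1).primeFactors.filter (k < ·)) ?_ fun r _ _ ↦ hr0 r)
            · refine Finset.sum_congr rfl fun r hr ↦ ?_
              rw [Finset.mem_filter, Nat.mem_primeFactors] at hr
              rw [if_pos ⟨hr.1.1, hr.2⟩, if_pos hr.1.2.1]
            · intro r hr
              rw [Finset.mem_filter, Nat.mem_primeFactors] at hr
              have := Nat.le_of_dvd (by omega) hr.1.2.1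
              rw [Finset.mem_range]
              omega
          · have : (if n.Prime then vonMangoldt.residueClass a n / (n : ℝ) ^ s else 0) = 0 := by
              split_ifs with hn
              · simp [vonMangoldt.residueClass, Set.indicator,
                  show ¬ (n : ZMod Q) = a from fun h ↦ hna ⟨hn, h⟩]
              · rfl
            rw [this, mul_zero]
            exact Finset.sum_nonneg fun r _ ↦ hr0 r
      _ = ∑ r ∈ Finset.range (N + 1), (if r.Prime ∧ k < r then (r : ℝ)⁻¹ *
          ∑ n ∈ Finset.range N,
            (if r ∣ n + 1 then vonMangoldt.residueClass a n / (n : ℝ) ^ s else 0) else 0) := by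
          rw [Finset.sum_comm]
          refine Finset.sum_congr rfl fun r _ ↦ ?_
          split_ifs
          · rw [Finset.mul_sum]
          · exact Finset.sum_const_zero
      _ ≤ ∑ r ∈ Finset.range (N + 1),
          (if r.Prime ∧ k < r then (r : ℝ)⁻¹ * shiftedSum a r s else 0) := by
          refine Finset.sum_le_sum fun r _ ↦ ?_
          split_ifs
          · refine mul_le_mul_of_nonneg_left ?_ (by positivity)
            refine (summable_shiftedSum a r hs).sum_le_tsum _ fun n _ ↦ ?_
            have := residueClass_div_nonneg a n s
            split_ifs <;> positivity
          · exact le_rfl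
      _ ≤ _ := by
          refine (summable_inv_mul_shiftedSum a hk hs).sum_le_tsum _ fun r _ ↦ ?_
          have := shiftedSum_nonneg a r s
          split_ifs <;> positivity
  have hsplit : ∀ s : ℝ, 1 < s → ∑' n : ℕ, vonMangoldt.residueClass a n / (n : ℝ) ^ s - C ≤
      ∑' n : ℕ, (if n.Prime then vonMangoldt.residueClass a n / (n : ℝ) ^ s else 0) := by
    intro s hs
    have hCs := vonMangoldt.summable_residueClass_non_primes_div a
    have hps : Summable fun n : ℕ ↦
        (if n.Prime then vonMangoldt.residueClass a n / (n : ℝ) ^ s else 0) := by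
      refine (summable_residueClass_div a hs).of_nonneg_of_le (fun n ↦ ?_) fun n ↦ ?_ <;>
      · have := residueClass_div_nonneg a n s
        split_ifs <;> first | positivity | exact le_rfl
    rw [sub_le_iff_le_add, hC, ← hps.tsum_add hCs]
    refine (summable_residueClass_div a hs).tsum_le_tsum (fun n ↦ ?_) (hps.add hCs)
    split_ifs with hn
    · simp
    · rw [zero_add]
      rcases n.eq_zero_or_pos with rfl | hn0
      · simp
      have hn1 : (1 : ℝ) ≤ n := by exact_mod_cast hn0
      have := Real.self_le_rpow_of_one_le hn1 hs.le
      have := vonMangoldt.residueClass_nonneg a n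
      gcongr
  have hsub : Tendsto (fun s : ℝ ↦ s - 1) (𝓝[>] 1) (𝓝 0) := by
    have : Tendsto (fun s : ℝ ↦ s - 1) (𝓝 1) (𝓝 (1 - 1)) := tendsto_id.sub_const 1
    simpa using this.mono_left nhdsWithin_le_nhds
  have hlim := ((tendsto_sub_mul_tsum_residueClass ha).sub (hsub.mul_const C)).const_mul ε
  have hle := le_of_tendsto_of_tendsto hlim (tendsto_tsum_shiftedSum ha hk hQ) (by
    filter_upwards [self_mem_nhdsWithin] with s hs
    have hs0 : 0 ≤ s - 1 := sub_nonneg.2 (le_of_lt hs)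
    have h1 := hprimes s hs
    rw [tsum_mul_left] at h1
    have h2 := (mul_le_mul_of_nonneg_left (hsplit s hs) hε0.le).trans h1
    calc _ = (s - 1) * (ε * (∑' n : ℕ, vonMangoldt.residueClass a n / (n : ℝ) ^ s - C)) := by ring
      _ ≤ _ := mul_le_mul_of_nonneg_left h2 hs0
      _ = _ := by
        rw [← tsum_mul_left]
        exact tsum_congr fun r ↦ by split_ifs <;> simp)
  have hφ : 0 < (Q.totient : ℝ)⁻¹ := inv_pos.2 (by exact_mod_cast Nat.totient_pos.2 Q.pos_of_neZero)
  have htail := tsum_inv_mul_pred_le (k := k) (by omega)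
  have := mul_le_mul_of_nonneg_left htail hφ.le
  have := mul_lt_mul_of_pos_left hε hφ
  rw [zero_mul, sub_zero] at hle
  linarith

lemma one_sub_sum_le_prod_one_sub {ι : Type*} (S : Finset ι) {f : ι → ℝ} (h0 : ∀ i ∈ S, 0 ≤ f i)
    (h1 : ∀ i ∈ S, f i ≤ 1) : 1 - ∑ i ∈ S, f i ≤ ∏ i ∈ S, (1 - f i) := by
  classical
  induction S using Finset.induction_on with
  | empty => simp
  | insert i S hi ih =>
    rw [Finset.sum_insert hi, Finset.prod_insert hi]
    have ih' := ih (fun j hj ↦ h0 j (Finset.mem_insert_of_mem hj))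
      (fun j hj ↦ h1 j (Finset.mem_insert_of_mem hj))
    have hi0 := h0 i (Finset.mem_insert_self _ _)
    have hi1 := h1 i (Finset.mem_insert_self _ _)
    have hs : 0 ≤ ∑ j ∈ S, f j :=
      Finset.sum_nonneg fun j hj ↦ h0 j (Finset.mem_insert_of_mem hj)
    have := mul_le_mul_of_nonneg_left ih' (sub_nonneg.2 hi1)
    nlinarith [mul_nonneg hi0 hs]

/-- The product of `1 - 1/r` over the primes `r` in `(N, k]`. -/
noncomputable def primeProd (N k : ℕ) : ℝ := ∏ r ∈ Finset.Ioc N k with r.Prime, (1 - (r : ℝ)⁻¹)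

lemma inv_le_one_of_prime {r : ℕ} (hr : r.Prime) : (r : ℝ)⁻¹ ≤ 1 :=
  inv_le_one_of_one_le₀ (by exact_mod_cast hr.one_le)

lemma primeProd_nonneg (N k : ℕ) : 0 ≤ primeProd N k :=
  Finset.prod_nonneg fun _ hr ↦ sub_nonneg.2 (inv_le_one_of_prime (Finset.mem_filter.1 hr).2)

lemma primeProd_le_one (N k : ℕ) : primeProd N k ≤ 1 :=
  Finset.prod_le_one
    (fun _ hr ↦ sub_nonneg.2 (inv_le_one_of_prime (Finset.mem_filter.1 hr).2))
    fun _ _ ↦ sub_le_self _ (by positivity)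

lemma exists_primeProd_lt (N : ℕ) {δ : ℝ} (hδ : 0 < δ) : ∃ k, N ≤ k ∧ primeProd N k < δ := by
  set f : ℕ → ℝ := Set.indicator {p | p.Prime} fun n : ℕ ↦ (1 : ℝ) / n with hf
  have hf0 : ∀ n, 0 ≤ f n := fun n ↦ Set.indicator_nonneg (fun n _ ↦ by positivity) n
  have hdiv := (not_summable_iff_tendsto_nat_atTop_of_nonneg hf0).1 not_summable_one_div_on_primes
  obtain ⟨m, hm⟩ := (hdiv.eventually_gt_atTop
    (∑ i ∈ Finset.range (N + 1), f i - Real.log δ)).exists_forall_of_atTop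
  refine ⟨max N m, le_max_left _ _, ?_⟩
  have hk := hm (max N m + 1) (by omega)
  set k := max N m
  have hsum : ∑ i ∈ Finset.range (k + 1), f i = ∑ i ∈ Finset.range (N + 1), f i +
      ∑ i ∈ Finset.Ioc N k with i.Prime, (i : ℝ)⁻¹ := by
    rw [Finset.sum_filter, ← Finset.sum_range_add_sum_Ico f (show N + 1 ≤ k + 1 by omega)]
    congr 1
    refine Finset.sum_congr (by ext; simp) fun i _ ↦ ?_
    simp [hf, Set.indicator]
  calc primeProd N k ≤ ∏ i ∈ Finset.Ioc N k with i.Prime, Real.exp (-(i : ℝ)⁻¹) :=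
        Finset.prod_le_prod (fun r hr ↦ sub_nonneg.2 (inv_le_one_of_prime (Finset.mem_filter.1 hr).2))
          fun r _ ↦ Real.one_sub_le_exp_neg _
    _ = Real.exp (-∑ i ∈ Finset.Ioc N k with i.Prime, (i : ℝ)⁻¹) := by
        rw [← Real.exp_sum, Finset.sum_neg_distrib]
    _ < Real.exp (Real.log δ) := Real.exp_lt_exp.2 (by linarith)
    _ = δ := Real.exp_log hδ

lemma exists_primeProd_approx {N : ℕ} (hN : 0 < N) {t δ : ℝ} (ht0 : 0 ≤ t) (ht1 : t ≤ 1)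
    (hδ : 1 / N ≤ δ) : ∃ k, N ≤ k ∧ t ≤ primeProd N k ∧ primeProd N k < t + δ := by
  classical
  have hδ0 : 0 < δ := lt_of_lt_of_le (by positivity) hδ
  have hex := exists_primeProd_lt N (show 0 < t + δ by linarith)
  obtain ⟨hNk, hlt⟩ := Nat.find_spec hex
  refine ⟨Nat.find hex, hNk, ?_, hlt⟩
  rcases hNk.eq_or_lt with h | h
  · rw [← h]
    simpa [primeProd] using ht1
  · obtain ⟨m, hm⟩ := Nat.exists_eq_succ_of_ne_zero (n := Nat.find hex) (by omega)
    have hmin := Nat.find_min hex (m := m) (by omega)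
    have hNm : N ≤ m := by omega
    have hge : t + δ ≤ primeProd N m := by
      by_contra hcon
      exact hmin ⟨hNm, not_le.1 hcon⟩
    rw [hm, Nat.succ_eq_add_one, primeProd, ← Finset.insert_Ioc_right_eq_Ioc_add_one hNm,
      Finset.filter_insert]
    split_ifs with hp
    · rw [Finset.prod_insert (by simp)]
      change t ≤ _ * primeProd N m
      have h1 : ((m + 1 : ℕ) : ℝ)⁻¹ ≤ 1 / N := by
        rw [← one_div]
        have : (0 : ℝ) < N := by exact_mod_cast hN
        gcongr
        omega
      have h2 := primeProd_le_one N m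
      have h3 : (0 : ℝ) ≤ ((m + 1 : ℕ) : ℝ)⁻¹ := by positivity
      nlinarith
    · change t ≤ primeProd N m
      linarith

lemma exists_isUnit_zmod_of_disjoint {S T : Finset ℕ} (hS : ∀ r ∈ S, r.Prime)
    (hT : ∀ r ∈ T, r.Prime) (hST : Disjoint S T) :
    ∃ Q : ℕ, Q ≠ 0 ∧ (∀ r : ℕ, r.Prime → r ∉ S → r ∉ T → Q.Coprime r) ∧
      ∃ a : ZMod Q, IsUnit a ∧ ∀ n : ℕ, (n : ZMod Q) = a →
        (∀ r ∈ S, r ∣ n + 1) ∧ ∀ r ∈ T, (n : ZMod r) = 1 := by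
  have hcop : ∀ {U : Finset ℕ}, (∀ r ∈ U, r.Prime) → ∀ {q : ℕ}, q.Prime → q ∉ U →
      (∏ r ∈ U, r).Coprime q := fun hU q hq hqU ↦
    Nat.Coprime.prod_left fun r hr ↦
      (Nat.coprime_primes (hU r hr) hq).2 fun h ↦ hqU (h ▸ hr)
  have hAB : (∏ r ∈ S, r).Coprime (∏ r ∈ T, r) := Nat.Coprime.prod_right fun r hr ↦
    hcop hS (hT r hr) fun h ↦ Finset.disjoint_left.1 hST h hr
  refine ⟨(∏ r ∈ S, r) * ∏ r ∈ T, r, mul_ne_zero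
    (Finset.prod_ne_zero_iff.2 fun r hr ↦ (hS r hr).ne_zero)
    (Finset.prod_ne_zero_iff.2 fun r hr ↦ (hT r hr).ne_zero),
    fun r hr h1 h2 ↦ Nat.Coprime.mul_left (hcop hS hr h1) (hcop hT hr h2),
    (ZMod.chineseRemainder hAB).symm (-1, 1), ?_, fun n hn ↦ ?_⟩
  · exact (Prod.isUnit_iff.2 ⟨isUnit_one.neg, isUnit_one⟩).map (ZMod.chineseRemainder hAB).symm
  · rw [RingEquiv.eq_symm_apply, map_natCast, Prod.ext_iff] at hn
    obtain ⟨h1, h2⟩ := hn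
    simp only [Prod.fst_natCast, Prod.snd_natCast] at h1 h2
    refine ⟨fun r hr ↦ (Finset.dvd_prod_of_mem (fun r ↦ r) hr).trans
      ((ZMod.natCast_eq_zero_iff _ _).1 ?_),
      fun r hr ↦ ?_⟩
    · rw [Nat.cast_add, h1, Nat.cast_one, neg_add_cancel]
    · have := congrArg (ZMod.castHom (Finset.dvd_prod_of_mem (fun r ↦ r) hr) (ZMod r)) h2
      rwa [map_natCast, map_one] at this

lemma totient_eq_mul_prod (n : ℕ) :
    (n.totient : ℝ) = n * ∏ r ∈ n.primeFactors, (1 - (r : ℝ)⁻¹) := by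
  have := congrArg (Rat.cast : ℚ → ℝ) (Nat.totient_eq_mul_prod_factors n)
  push_cast at this
  exact this

/-- For `2 ≤ N ≤ k` there is a prime `p` such that `p + 1` is divisible by `2` and by all primes in
`(N, k]`, by no other prime up to `k`, and only by few primes exceeding `k`. -/
lemma exists_prime_totient_ratio_near {N k : ℕ} (hN : 2 ≤ N) (hk : N ≤ k) :
    ∃ p : ℕ, p.Prime ∧
      |((p + 1).totient : ℝ) / (p.totient : ℝ) - primeProd N k / 2| ≤ 1 / N := by
  set I : Finset ℕ := {r ∈ Finset.Ioc N k | r.Prime} with hI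
  set S : Finset ℕ := insert 2 I with hS
  set T : Finset ℕ := {r ∈ Finset.Ioc 2 N | r.Prime} with hT
  have h2I : 2 ∉ I := by
    simp only [hI, Finset.mem_filter, Finset.mem_Ioc]
    omega
  have hSp : ∀ r ∈ S, r.Prime ∧ r ≤ k := by
    intro r hr
    rcases Finset.mem_insert.1 hr with rfl | hr
    · exact ⟨Nat.prime_two, by omega⟩
    · rw [hI, Finset.mem_filter, Finset.mem_Ioc] at hr
      exact ⟨hr.2, hr.1.2⟩
  have hTp : ∀ r ∈ T, r.Prime ∧ 2 < r ∧ r ≤ N := by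
    intro r hr
    rw [hT, Finset.mem_filter, Finset.mem_Ioc] at hr
    exact ⟨hr.2, hr.1⟩
  have hcover : ∀ r : ℕ, r.Prime → r ≤ k → r ∈ S ∨ r ∈ T := by
    intro r hr hrk
    have := hr.two_le
    simp only [hS, hT, hI, Finset.mem_insert, Finset.mem_filter, Finset.mem_Ioc, hr, and_true]
    omega
  have hdisj : Disjoint S T := Finset.disjoint_left.2 fun r hrS hrT ↦ by
    simp only [hS, hT, hI, Finset.mem_insert, Finset.mem_filter, Finset.mem_Ioc] at hrS hrT
    omega
  obtain ⟨Q, hQ0, hQ, a, ha, hres⟩ := exists_isUnit_zmod_of_disjoint (fun r hr ↦ (hSp r hr).1)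
    (fun r hr ↦ (hTp r hr).1) hdisj
  have : NeZero Q := ⟨hQ0⟩
  have hN0 : (0 : ℝ) < N := by exact_mod_cast (by omega : 0 < N)
  have hNk : (N : ℝ) ≤ k := by exact_mod_cast hk
  have hlt : 1 / (k : ℝ) < 2 / N := by
    rw [div_lt_div_iff₀ (by linarith) hN0]
    linarith
  obtain ⟨p, hp, hpa, hsum⟩ := exists_prime_sum_inv_lt ha (hN.trans hk) (fun r hr hrk ↦ hQ r hr
    (fun h ↦ absurd (hSp r h).2 (by omega)) (fun h ↦ absurd (hTp r h).2.2 (by omega))) hlt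
  obtain ⟨hpS, hpT⟩ := hres p hpa
  have hkp : k < p := by
    by_contra hcon
    rcases hcover p hp (not_lt.1 hcon) with h | h
    · have := (Nat.dvd_add_right (dvd_refl p)).1 (hpS p h)
      exact hp.one_lt.ne' (Nat.dvd_one.1 this)
    · have : Fact p.Prime := ⟨hp⟩
      have := hpT p h
      rw [ZMod.natCast_self] at this
      exact zero_ne_one this
  have hsmall : {r ∈ (p + 1).primeFactors | ¬ k < r} = S := by
    ext r
    rw [Finset.mem_filter, Nat.mem_primeFactors, not_lt]
    constructor
    · rintro ⟨⟨hr, hrp, -⟩, hrk⟩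
      refine (hcover r hr hrk).resolve_right fun h ↦ ?_
      have h1 := hpT r h
      have h2 : ((p + 1 : ℕ) : ZMod r) = 0 := (ZMod.natCast_eq_zero_iff _ _).2 hrp
      rw [Nat.cast_add, h1, Nat.cast_one, one_add_one_eq_two] at h2
      have h3 : r ∣ 2 := (ZMod.natCast_eq_zero_iff 2 r).1 (by exact_mod_cast h2)
      have := Nat.le_of_dvd two_pos h3
      have := (hTp r h).2.1
      omega
    · exact fun h ↦ ⟨⟨(hSp r h).1, hpS r h, by omega⟩, (hSp r h).2⟩
  set E : ℝ := ∏ r ∈ (p + 1).primeFactors with k < r, (1 - (r : ℝ)⁻¹) with hE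
  have hprime : ∀ r ∈ {r ∈ (p + 1).primeFactors | k < r}, r.Prime := fun r hr ↦
    (Nat.mem_primeFactors.1 (Finset.mem_filter.1 hr).1).1
  have hE1 : E ≤ 1 := Finset.prod_le_one
    (fun r hr ↦ sub_nonneg.2 (inv_le_one_of_prime (hprime r hr)))
    fun r _ ↦ sub_le_self _ (by positivity)
  have hE0 : 1 - 2 / N ≤ E := le_trans (by linarith)
    (one_sub_sum_le_prod_one_sub _ (fun r _ ↦ by positivity)
      fun r hr ↦ inv_le_one_of_prime (hprime r hr))
  have htot : ((p + 1).totient : ℝ) = (p + 1) * (primeProd N k / 2 * E) := by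
    rw [totient_eq_mul_prod, ← Finset.prod_filter_mul_prod_filter_not _ (k < ·), hsmall, hS,
      Finset.prod_insert h2I, ← hE]
    change _ = ((p : ℝ) + 1) * ((∏ r ∈ I, (1 - (r : ℝ)⁻¹)) / 2 * E)
    push_cast
    ring
  refine ⟨p, hp, ?_⟩
  have hpN : (N : ℝ) ≤ p - 1 := by
    have : (N + 1 : ℝ) ≤ p := by exact_mod_cast (by omega : N + 1 ≤ p)
    linarith
  have hp0 : (0 : ℝ) < p - 1 := by linarith
  have hc : ((p + 1).totient : ℝ) / (p.totient : ℝ) =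
      (1 + 2 / ((p : ℝ) - 1)) * (primeProd N k / 2 * E) := by
    rw [htot, Nat.totient_prime hp, Nat.cast_sub hp.one_le, Nat.cast_one]
    field_simp
    ring
  have hP0 := primeProd_nonneg N k
  have hP1 := primeProd_le_one N k
  have hd0 : 0 ≤ 2 / ((p : ℝ) - 1) := by positivity
  have hd1 : 2 / ((p : ℝ) - 1) ≤ 2 / N := by gcongr
  have hE00 : 0 ≤ E := Finset.prod_nonneg fun r hr ↦
    sub_nonneg.2 (inv_le_one_of_prime (hprime r hr))
  have hN2 : 1 / (N : ℝ) = 2 / N / 2 := by ring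
  rw [hc, hN2, abs_le]
  set d := 2 / ((p : ℝ) - 1)
  set e := 2 / (N : ℝ)
  have hlow : 1 - e ≤ (1 + d) * E := by nlinarith [mul_nonneg hd0 hE00]
  have hhigh : (1 + d) * E ≤ 1 + e := by nlinarith
  have he : 0 ≤ e := hd0.trans hd1
  constructor
  · nlinarith [mul_le_mul_of_nonneg_left hlow hP0]
  · nlinarith [mul_le_mul_of_nonneg_left hhigh hP0]

end

/-- The set `{φ(p+1)/φ(p) : p prime}` is dense in the interval `[0, 1/2]`. -/
theorem totient_ratio_prime_dense :
    ∀ x : ℝ, x ∈ Set.Icc (0 : ℝ) (1 / 2) →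
      x ∈ closure {r : ℝ | ∃ p : ℕ, Nat.Prime p ∧
        r = (Nat.totient (p + 1) : ℝ) / (Nat.totient p : ℝ)} := by
  intro x hx
  refine Metric.mem_closure_iff.2 fun δ hδ ↦ ?_
  obtain ⟨M, hM⟩ := exists_nat_gt (2 / δ)
  obtain ⟨N, hN, hMN⟩ : ∃ N, 2 ≤ N ∧ M ≤ N := ⟨max 2 M, le_max_left _ _, le_max_right _ _⟩
  have hN0 : (0 : ℝ) < N := by exact_mod_cast (by omega : 0 < N)
  have hNδ : 1 / (N : ℝ) < δ / 2 := by
    have h1 : 2 / δ < N := hM.trans_le (by exact_mod_cast hMN)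
    rw [div_lt_iff₀ hδ] at h1
    rw [div_lt_div_iff₀ hN0 two_pos]
    linarith
  obtain ⟨k, hNk, hk1, hk2⟩ := exists_primeProd_approx (N := N) (t := 2 * x) (δ := δ) (by omega)
    (by linarith [hx.1]) (by linarith [hx.2]) (by linarith)
  obtain ⟨p, hp, hpr⟩ := exists_prime_totient_ratio_near hN hNk
  refine ⟨_, ⟨p, hp, rfl⟩, ?_⟩
  rw [abs_le] at hpr
  rw [dist_comm, Real.dist_eq, abs_lt]
  constructor <;> linarith [hpr.1, hpr.2]
end

section
/- Assume Dickson's conjecture. Then the set of real numbers { φ(p+1)/φ(p) : p is prime and p+2 is prime } is dense in the interval [0, 1/3], i.e., every real number x with 0 ≤ x ≤ 1/3 is a limit point of this set. -/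
/-- The product of `6` with all the primes in `[K, K + n)`. -/
def sixMulPrimes (K n : ℕ) : ℕ :=
  6 * ∏ i ∈ (Finset.range n).filter (fun i => (K + i).Prime), (K + i)

lemma sixMulPrimes_pos (K n : ℕ) : 0 < sixMulPrimes K n := by
  refine Nat.mul_pos (by norm_num) (Finset.prod_pos fun i hi => ?_)
  exact (Finset.mem_filter.1 hi).2.pos

lemma sixMulPrimes_succ_of_prime {K n : ℕ} (h : (K + n).Prime) :
    sixMulPrimes K (n + 1) = (K + n) * sixMulPrimes K n := by
  rw [sixMulPrimes, sixMulPrimes, Finset.range_add_one, Finset.filter_insert, if_pos h,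
    Finset.prod_insert (by simp)]
  ring

lemma sixMulPrimes_succ_of_not_prime {K n : ℕ} (h : ¬ (K + n).Prime) :
    sixMulPrimes K (n + 1) = sixMulPrimes K n := by
  rw [sixMulPrimes, sixMulPrimes, Finset.range_add_one, Finset.filter_insert, if_neg h]

lemma coprime_sixMulPrimes {K n : ℕ} (hK : 4 ≤ K) (h : (K + n).Prime) :
    (K + n).Coprime (sixMulPrimes K n) := by
  rw [h.coprime_iff_not_dvd, sixMulPrimes, h.prime.dvd_mul, h.prime.dvd_finsetProd_iff]
  rintro (h6 | ⟨i, hi, hdvd⟩)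
  · have h23 : K + n ∣ 2 * 3 := h6
    rcases h.dvd_mul.1 h23 with h2 | h3
    · have := Nat.le_of_dvd (by norm_num) h2
      omega
    · have := Nat.le_of_dvd (by norm_num) h3
      omega
  · rw [Finset.mem_filter, Finset.mem_range] at hi
    have := Nat.le_of_dvd hi.2.pos hdvd
    omega

lemma totient_sixMulPrimes_div_succ {K n : ℕ} (hK : 4 ≤ K) :
    (Nat.totient (sixMulPrimes K (n + 1)) : ℝ) / sixMulPrimes K (n + 1) =
      (Nat.totient (sixMulPrimes K n) : ℝ) / sixMulPrimes K n *
        (1 - Set.indicator {p : ℕ | p.Prime} (fun m : ℕ => (1 : ℝ) / m) (n + K)) := by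
  rw [add_comm n K]
  by_cases h : (K + n).Prime
  · have hM : (sixMulPrimes K n : ℝ) ≠ 0 := by exact_mod_cast (sixMulPrimes_pos K n).ne'
    have hp : ((K + n : ℕ) : ℝ) ≠ 0 := by exact_mod_cast h.ne_zero
    rw [sixMulPrimes_succ_of_prime h, Nat.totient_mul (coprime_sixMulPrimes hK h),
      Nat.totient_prime h, Set.indicator_of_mem (show K + n ∈ {p : ℕ | p.Prime} from h),
      Nat.cast_mul, Nat.cast_mul, Nat.cast_pred h.pos]
    field_simp
  · rw [sixMulPrimes_succ_of_not_prime h,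
      Set.indicator_of_notMem (show K + n ∉ {p : ℕ | p.Prime} from h)]
    simp

lemma tendsto_totient_sixMulPrimes_div {K : ℕ} (hK : 4 ≤ K) :
    Filter.Tendsto (fun n => (Nat.totient (sixMulPrimes K n) : ℝ) / sixMulPrimes K n)
      Filter.atTop (nhds 0) := by
  set a : ℕ → ℝ := Set.indicator {p : ℕ | p.Prime} (fun m : ℕ => (1 : ℝ) / m) with ha
  have ha0 : ∀ n, 0 ≤ a n := fun n => Set.indicator_nonneg (fun m _ => by positivity) n
  have hsum : Filter.Tendsto (fun n => ∑ i ∈ Finset.range n, a (i + K))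
      Filter.atTop Filter.atTop := by
    rw [← not_summable_iff_tendsto_nat_atTop_of_nonneg (fun n => ha0 _), summable_nat_add_iff]
    exact not_summable_one_div_on_primes
  have hle : ∀ n, (Nat.totient (sixMulPrimes K n) : ℝ) / sixMulPrimes K n ≤
      Real.exp (-∑ i ∈ Finset.range n, a (i + K)) := by
    intro n
    induction n with
    | zero =>
      simp only [Finset.range_zero, Finset.sum_empty, neg_zero, Real.exp_zero]
      exact div_le_one_of_le₀ (by exact_mod_cast Nat.totient_le _) (by positivity)
    | succ n ih =>
      rw [totient_sixMulPrimes_div_succ hK, Finset.sum_range_succ, neg_add, Real.exp_add]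
      exact (mul_le_mul_of_nonneg_left (Real.one_sub_le_exp_neg _) (by positivity)).trans
        (mul_le_mul_of_nonneg_right ih (Real.exp_pos _).le)
  exact squeeze_zero (fun n => by positivity) hle
    (Real.tendsto_exp_neg_atTop_nhds_zero.comp hsum)

/-- The values `φ(M) / M` with `6 ∣ M` are dense in `[0, 1/3]`. -/
lemma exists_totient_div_near {x ε : ℝ} (hx : x ∈ Set.Icc (0 : ℝ) (1 / 3)) (hε : 0 < ε) :
    ∃ M : ℕ, 0 < M ∧ 6 ∣ M ∧ |(Nat.totient M : ℝ) / M - x| < ε := by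
  obtain ⟨N, hN⟩ := exists_nat_gt (1 / ε)
  set K := N + 4 with hKdef
  have hK : 4 ≤ K := by omega
  have hKε : 1 / (K : ℝ) < ε := by
    rw [one_div_lt (by positivity) hε, hKdef]
    push_cast
    linarith
  have hex : ∃ n, (Nat.totient (sixMulPrimes K n) : ℝ) / sixMulPrimes K n < x + ε :=
    ((tendsto_totient_sixMulPrimes_div hK).eventually_lt_const
      (show 0 < x + ε by linarith [hx.1])).exists
  classical
  refine ⟨sixMulPrimes K (Nat.find hex), sixMulPrimes_pos _ _, Dvd.intro _ rfl, ?_⟩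
  have hlt := Nat.find_spec hex
  rw [abs_lt]
  refine ⟨?_, by linarith⟩
  rcases hfind : Nat.find hex with _ | m
  · have h0 : (Nat.totient (sixMulPrimes K 0) : ℝ) / sixMulPrimes K 0 = 1 / 3 := by
      have h6 : Nat.totient 6 = 2 := by decide
      simp [sixMulPrimes, h6]
      norm_num
    rw [h0]
    linarith [hx.2]
  · have hm := not_lt.1 (Nat.find_min hex (show m < Nat.find hex by omega))
    have hle : (Nat.totient (sixMulPrimes K m) : ℝ) / sixMulPrimes K m ≤ 1 :=
      div_le_one_of_le₀ (by exact_mod_cast Nat.totient_le _) (by positivity)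
    have hind : Set.indicator {p : ℕ | p.Prime} (fun j : ℕ => (1 : ℝ) / j) (m + K) ≤ 1 / K := by
      refine Set.indicator_apply_le' (fun _ => ?_) (fun _ => by positivity)
      exact one_div_le_one_div_of_le (by positivity) (by exact_mod_cast Nat.le_add_left K m)
    have hpos : 0 ≤ Set.indicator {p : ℕ | p.Prime} (fun j : ℕ => (1 : ℝ) / j) (m + K) :=
      Set.indicator_nonneg (fun j _ => by positivity) _
    rw [totient_sixMulPrimes_div_succ hK]
    nlinarith

/-- Under Dickson's conjecture, for every `M > 0` divisible by `6` there are arbitrarily large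
primes `t` such that `M t - 1` and `M t + 1` are both prime. -/
lemma DicksonConjecture.exists_twin (hD : DicksonConjecture) {M : ℕ} (hM : 0 < M) (h6 : 6 ∣ M)
    (B : ℕ) :
    ∃ t p : ℕ, B < t ∧ t.Prime ∧ p.Prime ∧ (p + 2).Prime ∧ p + 1 = M * t := by
  have hinf := hD 3 ![1, M, M] ![0, -1, 1]
    (by
      intro i
      fin_cases i <;> simp [hM])
    (by
      intro q hq
      have : Fact q.Prime := ⟨hq⟩
      suffices h : ∃ t : ℤ, (t : ZMod q) * ((M * t - 1) * (M * t + 1)) ≠ 0 by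
        obtain ⟨t, ht⟩ := h
        refine ⟨t, fun hdvd => ht ?_⟩
        rw [← ZMod.intCast_zmod_eq_zero_iff_dvd] at hdvd
        simp only [Fin.prod_univ_three, Matrix.cons_val] at hdvd
        push_cast at hdvd
        linear_combination hdvd
      by_cases hqM : (M : ZMod q) = 0
      · exact ⟨1, by simp [hqM]⟩
      · have h6q : (6 : ZMod q) ≠ 0 := by
          obtain ⟨c, rfl⟩ := h6
          intro h
          apply hqM
          push_cast
          rw [h, zero_mul]
        obtain ⟨t, ht⟩ := ZMod.intCast_surjective (2 * (M : ZMod q)⁻¹)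
        refine ⟨t, fun h => h6q ?_⟩
        rw [ht] at h
        field_simp at h
        linear_combination h)
  obtain ⟨t, ht, hBt⟩ := hinf.exists_gt B
  have h0 := ht 0
  have h1 := ht 1
  have h2 := ht 2
  simp only [Matrix.cons_val, one_mul, add_zero] at h0 h1 h2
  have htp : t.Prime := Nat.prime_iff_prime_int.2 h0
  have hpos : 1 ≤ M * t := Nat.mul_pos hM htp.pos
  obtain ⟨p, hp⟩ := Nat.exists_eq_add_of_le' hpos
  have hpz : (M : ℤ) * t = p + 1 := by exact_mod_cast hp
  refine ⟨t, p, hBt, htp, Nat.prime_iff_prime_int.2 ?_, Nat.prime_iff_prime_int.2 ?_, hp.symm⟩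
  · convert h1 using 1
    linarith
  · convert h2 using 1
    push_cast
    linarith

lemma abs_totient_div_sub_le {M t p : ℕ} (hM : 2 ≤ M) (hMt : M < t) (ht : t.Prime)
    (hp : p.Prime) (h : p + 1 = M * t) :
    |(Nat.totient (p + 1) : ℝ) / Nat.totient p - (Nat.totient M : ℝ) / M| ≤ 1 / t := by
  have hcop : M.Coprime t :=
    (ht.coprime_iff_not_dvd.2 (Nat.not_dvd_of_pos_of_lt (by omega) hMt)).symm
  have hpM : (p : ℝ) = M * t - 1 := by
    have : (p : ℝ) + 1 = M * t := by exact_mod_cast h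
    linarith
  have hM' : (2 : ℝ) ≤ M := by exact_mod_cast hM
  have ht' : (2 : ℝ) ≤ t := by exact_mod_cast ht.two_le
  have hφ : (Nat.totient M : ℝ) ≤ M := by exact_mod_cast Nat.totient_le M
  have hden : (0 : ℝ) < M * t - 2 := by nlinarith
  have key : (Nat.totient (p + 1) : ℝ) / Nat.totient p - (Nat.totient M : ℝ) / M =
      -((Nat.totient M / M) * ((M - 2) / (M * t - 2))) := by
    rw [h, Nat.totient_mul hcop, Nat.totient_prime ht, Nat.totient_prime hp, Nat.cast_mul,
      Nat.cast_pred ht.pos, Nat.cast_pred hp.pos, hpM,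
      show (M : ℝ) * t - 1 - 1 = M * t - 2 by ring]
    have hM0 : (M : ℝ) ≠ 0 := by linarith
    rw [div_mul_div_comm, div_sub_div _ _ hden.ne' hM0, ← neg_div,
      div_eq_div_iff (mul_ne_zero hden.ne' hM0) (mul_ne_zero hM0 hden.ne')]
    ring
  have hfrac : ((M : ℝ) - 2) / (M * t - 2) ≤ 1 / t := by
    rw [div_le_div_iff₀ hden (by linarith)]
    nlinarith
  have hfrac0 : 0 ≤ ((M : ℝ) - 2) / (M * t - 2) := div_nonneg (by linarith) hden.le
  rw [key, abs_neg, abs_of_nonneg (by positivity)]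
  exact (mul_le_of_le_one_left hfrac0 (div_le_one_of_le₀ hφ (by linarith))).trans hfrac

/-- Assuming Dickson's conjecture, the set `{φ(p+1)/φ(p) : p, p+2 both prime}` is dense
in the interval `[0, 1/3]`. -/
theorem totient_ratio_twin_dense_third (hD : DicksonConjecture) :
    ∀ x : ℝ, x ∈ Set.Icc (0 : ℝ) (1 / 3) →
      x ∈ closure {r : ℝ | ∃ p : ℕ, Nat.Prime p ∧ Nat.Prime (p + 2) ∧
        r = (Nat.totient (p + 1) : ℝ) / (Nat.totient p : ℝ)} := by
  intro x hx
  rw [Metric.mem_closure_iff]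
  intro ε hε
  obtain ⟨M, hM, h6, hMx⟩ := exists_totient_div_near hx (half_pos hε)
  obtain ⟨N, hN⟩ := exists_nat_gt (1 / (ε / 2))
  obtain ⟨t, p, hBt, ht, hp, hp2, hpt⟩ := hD.exists_twin hM h6 (M + N)
  refine ⟨_, ⟨p, hp, hp2, rfl⟩, ?_⟩
  have hclose := abs_totient_div_sub_le (by have := Nat.le_of_dvd hM h6; omega)
    (show M < t by omega) ht hp hpt
  have hNt : (N : ℝ) < t := by exact_mod_cast (show N < t by omega)
  have htε : 1 / (t : ℝ) < ε / 2 := by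
    rw [one_div_lt (by exact_mod_cast ht.pos) (half_pos hε)]
    linarith
  rw [dist_comm, Real.dist_eq]
  linarith [abs_sub_le ((Nat.totient (p + 1) : ℝ) / Nat.totient p) ((Nat.totient M : ℝ) / M) x]
end

section
/- Let P be a finite set of prime numbers. Then the set of real numbers { φ(n)/n : n is a squarefree positive integer such that no prime in P divides n } is dense in the interval [0, 1], i.e., every real number x with 0 ≤ x ≤ 1 is a limit point of this set. -/
/-- The indicator function of the primes, weighted by reciprocals. -/
noncomputable def primeReciprocal : ℕ → ℝ :=
  Set.indicator {p : ℕ | p.Prime} fun n : ℕ => (1 : ℝ) / n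

lemma primeReciprocal_nonneg (n : ℕ) : 0 ≤ primeReciprocal n :=
  Set.indicator_nonneg (fun _ _ => by positivity) n

lemma primeReciprocal_le (n : ℕ) : primeReciprocal n ≤ 1 / n :=
  Set.indicator_le_self' (fun _ _ => by positivity) n

lemma primeReciprocal_le_one (n : ℕ) : primeReciprocal n ≤ 1 := by
  refine (primeReciprocal_le n).trans ?_
  rcases Nat.eq_zero_or_pos n with rfl | h
  · simp
  · rw [div_le_one (by exact_mod_cast h)]
    exact_mod_cast h

/-- The product of the primes in `[N, N + k)` realizes the corresponding partial Euler product. -/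
lemma exists_squarefree_totient_div_eq_prod (N k : ℕ) :
    ∃ n : ℕ, 0 < n ∧ Squarefree n ∧ (∀ p, p.Prime → p ∣ n → N ≤ p ∧ p < N + k) ∧
      (Nat.totient n : ℝ) / n = ∏ i ∈ Finset.range k, (1 - primeReciprocal (i + N)) := by
  induction k with
  | zero =>
    refine ⟨1, one_pos, squarefree_one, fun p hp h => ?_, by simp⟩
    exact absurd (Nat.dvd_one.mp h) hp.ne_one
  | succ k ih =>
    obtain ⟨n, hn, hsq, hfac, hprod⟩ := ih
    by_cases hq : (k + N).Prime
    · have hcop : n.Coprime (k + N) := by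
        rw [Nat.coprime_comm, hq.coprime_iff_not_dvd]
        intro h
        have := hfac _ hq h
        omega
      refine ⟨n * (k + N), Nat.mul_pos hn hq.pos,
        (Nat.squarefree_mul hcop).mpr ⟨hsq, hq.prime.squarefree⟩, fun p hp h => ?_, ?_⟩
      · rcases hp.dvd_mul.mp h with h | h
        · have := hfac p hp h
          omega
        · have := (Nat.prime_dvd_prime_iff_eq hp hq).mp h
          omega
      · have hval : primeReciprocal (k + N) = 1 / ((k + N : ℕ) : ℝ) :=
          Set.indicator_of_mem (s := {p : ℕ | p.Prime}) hq _
        have hq0 : ((k + N : ℕ) : ℝ) ≠ 0 := by exact_mod_cast hq.ne_zero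
        rw [Finset.prod_range_succ, ← hprod, hval, Nat.totient_mul hcop, Nat.totient_prime hq,
          Nat.cast_mul, Nat.cast_mul, mul_div_mul_comm, Nat.cast_pred hq.pos, sub_div,
          div_self hq0]
    · refine ⟨n, hn, hsq, fun p hp h => ?_, ?_⟩
      · have := hfac p hp h
        omega
      · have hval : primeReciprocal (k + N) = 0 :=
          Set.indicator_of_notMem (s := {p : ℕ | p.Prime}) hq _
        rw [Finset.prod_range_succ, ← hprod, hval, sub_zero, mul_one]

lemma tendsto_prod_one_sub_primeReciprocal (N : ℕ) :
    Filter.Tendsto (fun k => ∏ i ∈ Finset.range k, (1 - primeReciprocal (i + N)))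
      Filter.atTop (nhds 0) := by
  have hns : ¬ Summable fun i => primeReciprocal (i + N) := by
    rw [summable_nat_add_iff N]
    exact not_summable_one_div_on_primes
  have hsum := (not_summable_iff_tendsto_nat_atTop_of_nonneg
    fun i => primeReciprocal_nonneg (i + N)).mp hns
  refine squeeze_zero (fun k => Finset.prod_nonneg fun i _ =>
    sub_nonneg.mpr (primeReciprocal_le_one _)) (fun k => ?_)
    (Real.tendsto_exp_neg_atTop_nhds_zero.comp hsum)
  rw [Function.comp_apply, ← Finset.sum_neg_distrib, Real.exp_sum]
  exact Finset.prod_le_prod (fun i _ => sub_nonneg.mpr (primeReciprocal_le_one _))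
    fun i _ => Real.one_sub_le_exp_neg _

/-- A null sequence starting above `x ≥ 0` whose steps down are at most `ε` enters `[x, x + ε)`. -/
lemma exists_mem_Ico_of_tendsto_zero {f : ℕ → ℝ} {x ε : ℝ} (hx : 0 ≤ x) (hε : 0 < ε)
    (h0 : x ≤ f 0) (hstep : ∀ k, f k - ε ≤ f (k + 1))
    (hlim : Filter.Tendsto f Filter.atTop (nhds 0)) : ∃ k, f k ∈ Set.Ico x (x + ε) := by
  classical
  have hex : ∃ k, f k < x + ε := (hlim.eventually_lt_const (by linarith)).exists
  refine ⟨Nat.find hex, ?_, Nat.find_spec hex⟩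
  rcases hk : Nat.find hex with _ | m
  · exact h0
  · have hm := Nat.find_min hex (m := m) (by omega)
    linarith [hstep m]

/-- For any finite set `P` of primes, the set `{φ(n)/n : n squarefree positive,
no prime of `P` divides `n`}` is dense in `[0, 1]`. -/
theorem totient_over_n_dense (P : Finset ℕ) (hP : ∀ p ∈ P, Nat.Prime p) :
    ∀ x : ℝ, x ∈ Set.Icc (0 : ℝ) 1 →
      x ∈ closure {r : ℝ | ∃ n : ℕ, 0 < n ∧ Squarefree n ∧ (∀ p ∈ P, ¬ p ∣ n) ∧
        r = (Nat.totient n : ℝ) / (n : ℝ)} := by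
  rintro x ⟨hx0, hx1⟩
  rw [Metric.mem_closure_iff]
  intro ε hε
  obtain ⟨M, hM⟩ := exists_nat_one_div_lt hε
  set N := max (M + 1) (P.sup id + 1) with hN
  have hNε : (1 : ℝ) / (M + 1) ≤ ε := hM.le
  have hstep : ∀ k, ∏ i ∈ Finset.range k, (1 - primeReciprocal (i + N)) - ε ≤
      ∏ i ∈ Finset.range (k + 1), (1 - primeReciprocal (i + N)) := by
    intro k
    rw [Finset.prod_range_succ]
    have hle : primeReciprocal (k + N) ≤ ε := by
      refine ((primeReciprocal_le _).trans ?_).trans hNε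
      apply one_div_le_one_div_of_le (by positivity)
      have : M + 1 ≤ k + N := by omega
      exact_mod_cast this
    have hprod : ∏ i ∈ Finset.range k, (1 - primeReciprocal (i + N)) ≤ 1 :=
      Finset.prod_le_one (fun i _ => sub_nonneg.mpr (primeReciprocal_le_one _))
        fun i _ => sub_le_self _ (primeReciprocal_nonneg _)
    nlinarith [mul_le_mul_of_nonneg_right hprod (primeReciprocal_nonneg (k + N))]
  obtain ⟨k, hk1, hk2⟩ := exists_mem_Ico_of_tendsto_zero hx0 hε (by simpa using hx1) hstep
    (tendsto_prod_one_sub_primeReciprocal N)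
  obtain ⟨n, hn, hsq, hfac, hprod⟩ := exists_squarefree_totient_div_eq_prod N k
  refine ⟨_, ⟨n, hn, hsq, fun p hp hdvd => ?_, rfl⟩, ?_⟩
  · have h1 := (hfac p (hP p hp) hdvd).1
    have h2 : p ≤ P.sup id := Finset.le_sup (f := id) hp
    omega
  · rw [hprod, dist_comm, Real.dist_eq, abs_lt]
    constructor <;> linarith
end

section
/- The set of real numbers { φ(n)/n : n is a squarefree positive integer with n ≡ 2 (mod 4) } is dense in the interval [0, 1/2], i.e., every real number x with 0 ≤ x ≤ 1/2 is a limit point of this set. -/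
open Filter Topology in
/-- If `h` takes values in `[0, 1]` and is not summable, then `∏ (1 - h i)` diverges to `0`. -/
theorem tendsto_prod_one_sub_of_not_summable {h : ℕ → ℝ} (h0 : ∀ i, 0 ≤ h i)
    (h1 : ∀ i, h i ≤ 1) (hs : ¬ Summable h) :
    Tendsto (fun m ↦ ∏ i ∈ Finset.range m, (1 - h i)) atTop (𝓝 0) := by
  rw [not_summable_iff_tendsto_nat_atTop_of_nonneg h0] at hs
  refine squeeze_zero (fun m ↦ Finset.prod_nonneg fun i _ ↦ sub_nonneg.2 (h1 i)) (fun m ↦ ?_)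
    (Real.tendsto_exp_neg_atTop_nhds_zero.comp hs)
  simp only [Function.comp_apply]
  rw [← Finset.sum_neg_distrib, Real.exp_sum]
  exact Finset.prod_le_prod (fun i _ ↦ sub_nonneg.2 (h1 i))
    fun i _ ↦ Real.one_sub_le_exp_neg (h i)

/-- A finite set of primes has squarefree product. -/
theorem squarefree_prod_of_primes {T : Finset ℕ} (hT : ∀ p ∈ T, p.Prime) :
    Squarefree (∏ p ∈ T, p) := by
  refine Finset.squarefree_prod_of_pairwise_isCoprime (fun p hp q hq hpq ↦ ?_)
    fun p hp ↦ (hT p hp).prime.squarefree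
  exact Nat.coprime_iff_isRelPrime.1 ((Nat.coprime_primes (hT p hp) (hT q hq)).2 hpq)

/-- For a finite set `T` of primes with product `n`, `φ(n)/n = ∏ p ∈ T, (1 - 1/p)`. -/
theorem totient_div_prod_of_primes {T : Finset ℕ} (hT : ∀ p ∈ T, p.Prime) :
    (Nat.totient (∏ p ∈ T, p) : ℝ) / ((∏ p ∈ T, p : ℕ) : ℝ) = ∏ p ∈ T, (1 - 1 / (p : ℝ)) := by
  have hn : ((∏ p ∈ T, p : ℕ) : ℝ) ≠ 0 :=
    Nat.cast_ne_zero.2 (squarefree_prod_of_primes hT).ne_zero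
  have h := congrArg (fun q : ℚ ↦ (q : ℝ)) (Nat.totient_eq_mul_prod_factors (∏ p ∈ T, p))
  rw [Nat.primeFactors_prod hT] at h
  rw [div_eq_iff hn, mul_comm]
  simpa using h

/-- The product of a finite set of primes containing `2` is `2` modulo `4`. -/
theorem prod_primes_mod_four {T : Finset ℕ} (hT : ∀ p ∈ T, p.Prime) (h2 : 2 ∈ T) :
    (∏ p ∈ T, p) % 4 = 2 := by
  have hd : 2 ∣ ∏ p ∈ T, p := Finset.dvd_prod_of_mem (fun p ↦ p) h2
  have h4 : ¬ 2 * 2 ∣ ∏ p ∈ T, p := fun h ↦ by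
    simpa using squarefree_prod_of_primes hT 2 h
  omega

/-- A sequence tending to `0` from a start `≥ x ≥ 0`, with downward steps smaller than `ε`,
comes within `ε` of `x`. -/
theorem exists_abs_sub_lt_of_small_steps {f : ℕ → ℝ} {x ε : ℝ} (hx : 0 ≤ x) (hε : 0 < ε)
    (hf : Filter.Tendsto f Filter.atTop (nhds 0)) (hf0 : x ≤ f 0)
    (hstep : ∀ m, f m - f (m + 1) < ε) : ∃ m, |f m - x| < ε := by
  have hex : ∃ m, f m < x + ε := (hf.eventually_lt_const (by linarith)).exists
  classical
  refine ⟨Nat.find hex, ?_⟩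
  have hlt := Nat.find_spec hex
  rw [abs_lt]
  refine ⟨?_, by linarith⟩
  rcases hm : Nat.find hex with _ | m
  · linarith
  · have := Nat.find_min hex (m := m) (by omega)
    linarith [hstep m]

/-- The set `{φ(n)/n : n squarefree positive, n ≡ 2 (mod 4)}` is dense in `[0, 1/2]`. -/
theorem totient_over_n_two_mod_four_dense :
    ∀ x : ℝ, x ∈ Set.Icc (0 : ℝ) (1 / 2) →
      x ∈ closure {r : ℝ | ∃ n : ℕ, 0 < n ∧ Squarefree n ∧ n % 4 = 2 ∧
        r = (Nat.totient n : ℝ) / (n : ℝ)} := by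
  rintro x ⟨hx0, hx1⟩
  rw [Metric.mem_closure_iff]
  intro ε hε
  obtain ⟨N, hN⟩ := exists_nat_one_div_lt hε
  set K := N + 3 with hK
  set h : ℕ → ℝ := Set.indicator {p : ℕ | p.Prime} (fun p ↦ (1 : ℝ) / p) with hh
  have h0 : ∀ i, 0 ≤ h i := fun i ↦ Set.indicator_nonneg (fun p _ ↦ by positivity) i
  have hle : ∀ i, h i ≤ 1 / (i : ℝ) := fun i ↦
    Set.indicator_le_self' (fun _ _ ↦ by positivity) i
  have hsmall : ∀ i, h (i + K) ≤ 1 / ((N : ℝ) + 1) := fun i ↦ (hle _).trans <| by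
    apply one_div_le_one_div_of_le (by positivity)
    rw [hK]; push_cast; linarith [(Nat.cast_nonneg i : (0 : ℝ) ≤ i)]
  have h1 : ∀ i, h (i + K) ≤ 1 := fun i ↦ (hsmall i).trans <| by
    rw [div_le_one (by positivity)]; linarith [(Nat.cast_nonneg N : (0 : ℝ) ≤ N)]
  have hns : ¬ Summable fun i ↦ h (i + K) := by
    rw [summable_nat_add_iff K]; exact not_summable_one_div_on_primes
  set g : ℕ → ℝ := fun m ↦ ∏ i ∈ Finset.range m, (1 - h (i + K)) with hg
  have hg1 : ∀ m, g m ≤ 1 := fun m ↦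
    Finset.prod_le_one (fun i _ ↦ sub_nonneg.2 (h1 i)) fun i _ ↦ by linarith [h0 (i + K)]
  have hlim : Filter.Tendsto (fun m ↦ 1 / 2 * g m) Filter.atTop (nhds 0) := by
    simpa only [mul_zero] using
      (tendsto_prod_one_sub_of_not_summable (fun i ↦ h0 (i + K)) h1 hns).const_mul (1 / 2 : ℝ)
  obtain ⟨m, hm⟩ := exists_abs_sub_lt_of_small_steps hx0 hε hlim (by simpa [hg] using hx1)
    fun m ↦ by
      have hs : g (m + 1) = g m * (1 - h (m + K)) := Finset.prod_range_succ _ _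
      rw [hs]
      nlinarith [mul_le_mul_of_nonneg_right (hg1 m) (h0 (m + K)), hsmall m, h0 (m + K)]
  set S := (Finset.Ico K (K + m)).filter Nat.Prime with hS
  have h2S : 2 ∉ S := by simp [hS, hK]
  have hT : ∀ p ∈ insert 2 S, p.Prime := fun p hp ↦ by
    rcases Finset.mem_insert.1 hp with rfl | hp
    · exact Nat.prime_two
    · exact (Finset.mem_filter.1 hp).2
  have hgS : 1 / 2 * g m = ∏ p ∈ insert 2 S, (1 - 1 / (p : ℝ)) := by
    rw [Finset.prod_insert h2S, hS, Finset.prod_filter, Finset.prod_Ico_eq_prod_range]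
    congr 1
    · norm_num
    · rw [Nat.add_sub_cancel_left]
      refine Finset.prod_congr rfl fun i _ ↦ ?_
      rw [add_comm K i, hh, Set.indicator_apply]
      by_cases hp : (i + K).Prime <;> simp [hp]
  refine ⟨_, ⟨∏ p ∈ insert 2 S, p, (squarefree_prod_of_primes hT).ne_zero.bot_lt,
    squarefree_prod_of_primes hT, prod_primes_mod_four hT (Finset.mem_insert_self 2 S), rfl⟩, ?_⟩
  rwa [totient_div_prod_of_primes hT, ← hgS, dist_comm, Real.dist_eq]
end
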